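/- There exists a universal constant c₁ > 0 such that the following holds. Let Ω ⊆ ℝ³ be open, T ∈ (0,∞), and let u,d have the standard (u,d)-regularity on Ω_T. Then for every z₀ ∈ ℝ³×ℝ and ρ > 0 with Q*_ρ(z₀) ⊆ Ω_T and every γ ∈ (0,1]: C(γρ) ≤ c₁ ( γ³ A(ρ)^{3/2} + γ^{−3} A(ρ)^{3/4} B(ρ)^{3/4} ). -/

import Mathlib

open MeasureTheory Set Filter
open scoped ENNReal NNReal

noncomputable section

abbrev E3 : Type := EuclideanSpace ℝ (Fin 3)

/-- Space-time `ℝ³ × ℝ`. -/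
abbrev SpT : Type := E3 × ℝ

/-- Spatial partial derivative `∂_j` of a function on space-time. -/
def sderiv (j : Fin 3) (ψ : SpT → ℝ) (z : SpT) : ℝ :=
  fderiv ℝ ψ z ((EuclideanSpace.single j 1 : E3), (0 : ℝ))

/-- Time derivative `∂_t` of a function on space-time. -/
def tderiv (ψ : SpT → ℝ) (z : SpT) : ℝ :=
  fderiv ℝ ψ z ((0 : E3), (1 : ℝ))

/-- Spatial Laplacian of a function on space-time. -/
def sLap (ψ : SpT → ℝ) (z : SpT) : ℝ := ∑ j, sderiv j (sderiv j ψ) z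

/-- `ψ ∈ C_c^∞(U)`. -/
def IsTestOn (U : Set SpT) (ψ : SpT → ℝ) : Prop :=
  ContDiff ℝ (⊤ : ℕ∞) ψ ∧ HasCompactSupport ψ ∧ tsupport ψ ⊆ U

/-- `g` is the weak spatial gradient of `f` on `U`. -/
def WeakSGrad (U : Set SpT) (f : SpT → ℝ) (g : Fin 3 → SpT → ℝ) : Prop :=
  ∀ (j : Fin 3) (ψ : SpT → ℝ), IsTestOn U ψ →
    ∫ z in U, f z * sderiv j ψ z = - ∫ z in U, g j z * ψ z

/-- Squared Frobenius norm of a `3×3` array, e.g. `|∇v|² = Σ_{i,j} (∂_j v_i)²`. -/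
def nsq2 (M : Fin 3 → Fin 3 → ℝ) : ℝ := ∑ i, ∑ j, (M i j) ^ 2

/-- Squared norm of a `3×3×3` array, e.g. `|∇²d|² = Σ_{i,j,k} (∂_j ∂_k d_i)²`. -/
def nsq3 (A : Fin 3 → Fin 3 → Fin 3 → ℝ) : ℝ := ∑ i, ∑ j, ∑ k, (A i j k) ^ 2

/-- Open Euclidean ball in `ℝ³`. -/
def ball3 (x : E3) (r : ℝ) : Set E3 := Metric.ball x r

/-- Parabolic cylinder `Q_r(z₀) = B_r(x₀) × (t₀ - r², t₀)`. -/
def Qcyl (z : SpT) (r : ℝ) : Set SpT := ball3 z.1 r ×ˢ Ioo (z.2 - r ^ 2) z.2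

/-- Centered parabolic cylinder `Q*_r(z₀) = B_r(x₀) × (t₀ - (7/8)r², t₀ + (1/8)r²)`. -/
def Qstar (z : SpT) (r : ℝ) : Set SpT :=
  ball3 z.1 r ×ˢ Ioo (z.2 - 7 / 8 * r ^ 2) (z.2 + 1 / 8 * r ^ 2)

/-- The time interval `I*_r(t₀) = (t₀ - (7/8)r², t₀ + (1/8)r²)`. -/
def Istar (t₀ r : ℝ) : Set ℝ := Ioo (t₀ - 7 / 8 * r ^ 2) (t₀ + 1 / 8 * r ^ 2)

/-- Standard `(u,d)`-regularity on `Ω_T`, with weak spatial gradients `Du`, `Dd`, `D2d`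
(`Du z i j = ∂_j u_i`, `Dd z i j = ∂_j d_i`, `D2d z i j k = ∂_j ∂_k d_i`). -/
structure StdRegUD (Ω : Set E3) (T : ℝ) (u d : SpT → E3)
    (Du Dd : SpT → Fin 3 → Fin 3 → ℝ) (D2d : SpT → Fin 3 → Fin 3 → Fin 3 → ℝ) : Prop where
  meas_u : Measurable u
  meas_d : Measurable d
  meas_Du : Measurable Du
  meas_Dd : Measurable Dd
  meas_D2d : Measurable D2d
  grad_u : ∀ i : Fin 3, WeakSGrad (Ω ×ˢ Ioo 0 T) (fun z => u z i) (fun j z => Du z i j)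
  grad_d : ∀ i : Fin 3, WeakSGrad (Ω ×ˢ Ioo 0 T) (fun z => d z i) (fun j z => Dd z i j)
  grad_Dd : ∀ i k : Fin 3,
    WeakSGrad (Ω ×ˢ Ioo 0 T) (fun z => Dd z i k) (fun j z => D2d z i j k)
  linf_u : ∃ M : ℝ, ∀ᵐ t ∂(volume.restrict (Ioo 0 T)), ∫ x in Ω, ‖u (x, t)‖ ^ 2 ≤ M
  linf_d : ∃ M : ℝ, ∀ᵐ t ∂(volume.restrict (Ioo 0 T)), ∫ x in Ω, ‖d (x, t)‖ ^ 2 ≤ M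
  linf_Dd : ∃ M : ℝ, ∀ᵐ t ∂(volume.restrict (Ioo 0 T)), ∫ x in Ω, nsq2 (Dd (x, t)) ≤ M
  l2_Du : IntegrableOn (fun z => nsq2 (Du z)) (Ω ×ˢ Ioo 0 T)
  l2_D2d : IntegrableOn (fun z => nsq3 (D2d z)) (Ω ×ˢ Ioo 0 T)

/-- `A(r) = (1/r) esssup_{t ∈ I*_r} ∫_{B_r} (|u|² + |∇d|²) dx`. -/
def AQ (u : SpT → E3) (Dd : SpT → Fin 3 → Fin 3 → ℝ) (z₀ : SpT) (r : ℝ) : ℝ≥0∞ :=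
  (ENNReal.ofReal r)⁻¹ *
    essSup (fun t => ∫⁻ x in ball3 z₀.1 r, ENNReal.ofReal (‖u (x, t)‖ ^ 2 + nsq2 (Dd (x, t))))
      (volume.restrict (Istar z₀.2 r))

/-- `B(r) = (1/r) ∫∫_{Q*_r} (|∇u|² + |∇²d|²) dz`. -/
def BQ (Du : SpT → Fin 3 → Fin 3 → ℝ) (D2d : SpT → Fin 3 → Fin 3 → Fin 3 → ℝ)
    (z₀ : SpT) (r : ℝ) : ℝ≥0∞ :=
  (ENNReal.ofReal r)⁻¹ * ∫⁻ z in Qstar z₀ r, ENNReal.ofReal (nsq2 (Du z) + nsq3 (D2d z))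

/-- `C(r) = (1/r²) ∫∫_{Q*_r} (|u|³ + |∇d|³) dz`. -/
def CQ (u : SpT → E3) (Dd : SpT → Fin 3 → Fin 3 → ℝ) (z₀ : SpT) (r : ℝ) : ℝ≥0∞ :=
  (ENNReal.ofReal (r ^ 2))⁻¹ *
    ∫⁻ z in Qstar z₀ r, ENNReal.ofReal (‖u z‖ ^ 3 + Real.sqrt (nsq2 (Dd z)) ^ 3)

theorem exists_lintegral_eq_mul_lintegral_comp (L : (Fin 3 → ℝ) ≃L[ℝ] E3) :
    ∃ c : ℝ≥0, c ≠ 0 ∧ ∀ h : E3 → ℝ≥0∞, Measurable h →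
      ∫⁻ x, h x = c * ∫⁻ y, h (L y) := by
  obtain ⟨c, hc⟩ : ∃ c : ℝ≥0, (volume : Measure E3) = c • (volume : Measure (Fin 3 → ℝ)).map L :=
    ⟨_, Measure.isAddLeftInvariant_eq_smul _ _⟩
  refine ⟨c, ?_, fun h hh => ?_⟩
  · rintro rfl
    rw [zero_smul] at hc
    exact (NeZero.ne (volume : Measure E3)) hc
  · conv_lhs => rw [hc]
    rw [lintegral_smul_measure, lintegral_map hh L.continuous.measurable]
    rfl

/-- Loomis-Whitney inequality along the lines parallel to the vectors of a basis. -/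
theorem lintegral_prod_lintegral_line_le (b : Module.Basis (Fin 3) ℝ E3) :
    ∃ C : ℝ≥0, ∀ h : E3 → ℝ≥0∞, Measurable h →
      ∫⁻ x, ∏ i, (∫⁻ s : ℝ, h (x + s • b i)) ^ ((1 : ℝ) / 2) ≤
        C * (∫⁻ x, h x) ^ ((3 : ℝ) / 2) := by
  set L : (Fin 3 → ℝ) ≃L[ℝ] E3 := b.equivFun.symm.toContinuousLinearEquiv
  have hL : ∀ (y : Fin 3 → ℝ) (i : Fin 3) (s : ℝ),
      L (Function.update y i s) = L y + (s - y i) • b i := by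
    intro y i s
    have : Function.update y i s = y + (s - y i) • Pi.single i (1 : ℝ) := by
      ext j
      by_cases hj : j = i
      · subst hj; simp
      · simp [hj]
    rw [this, map_add, map_smul]
    congr 2
    simp [L, Module.Basis.equivFun_symm_apply, Pi.single_apply]
  obtain ⟨c, hc0, hc⟩ := exists_lintegral_eq_mul_lintegral_comp L
  refine ⟨c * (c⁻¹) ^ ((3 : ℝ) / 2), fun h hh => ?_⟩
  have hp : Real.HolderConjugate (Fintype.card (Fin 3)) (3 / 2) := by
    rw [Real.holderConjugate_iff]
    norm_num
  have hLm : Measurable L := L.continuous.measurable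
  have key := lintegral_prod_lintegral_pow_le (fun _ : Fin 3 => (volume : Measure ℝ)) hp
    (hh.comp hLm)
  rw [← volume_pi] at key
  have e1 : ∀ y : Fin 3 → ℝ, ∏ i, (∫⁻ s : ℝ, (h ∘ L) (Function.update y i s)) ^
      ((1 : ℝ) / (Fintype.card (Fin 3) - 1 : ℝ)) =
      ∏ i, (∫⁻ s : ℝ, h (L y + s • b i)) ^ ((1 : ℝ) / 2) := by
    intro y
    refine Finset.prod_congr rfl fun i _ => ?_
    simp only [Function.comp, hL]
    rw [lintegral_sub_right_eq_self (fun s : ℝ => h (L y + s • b i)) (y i)]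
    norm_num
  simp_rw [e1] at key
  have hm : Measurable fun x : E3 => ∏ i, (∫⁻ s : ℝ, h (x + s • b i)) ^ ((1 : ℝ) / 2) := by
    refine Finset.measurable_prod _ fun i _ => Measurable.pow_const ?_ _
    refine Measurable.lintegral_prod_right' (f := fun p : E3 × ℝ => h (p.1 + p.2 • b i)) ?_
    exact hh.comp (by fun_prop)
  rw [hc _ hm]
  have e2 : ∫⁻ y, (h ∘ L) y = (c : ℝ≥0∞)⁻¹ * ∫⁻ x, h x := by
    rw [hc _ hh, ← mul_assoc, ENNReal.inv_mul_cancel (by simpa using hc0) (by simp), one_mul]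
    rfl
  rw [e2, ENNReal.mul_rpow_of_nonneg _ _ (by norm_num)] at key
  calc _ ≤ (c : ℝ≥0∞) * ((c : ℝ≥0∞)⁻¹ ^ ((3 : ℝ) / 2) * (∫⁻ x, h x) ^ ((3 : ℝ) / 2)) := by
        gcongr
    _ = _ := by
        rw [ENNReal.coe_mul, ENNReal.coe_rpow_of_nonneg _ (by norm_num), ENNReal.coe_inv hc0,
          mul_assoc]

/-- The fundamental theorem of calculus on a segment, in `ℝ≥0∞`. -/
theorem enorm_sub_le_lintegral_fderiv {f : E3 → ℝ} (hf : ContDiff ℝ 1 f) (x v : E3) {s : ℝ}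
    (hs : s ∈ Ioc (0 : ℝ) 1) :
    ‖f (x + s • v) - f x‖ₑ ≤ ∫⁻ τ in Ioc (0 : ℝ) 1, ‖fderiv ℝ f (x + τ • v)‖ₑ * ‖v‖ₑ := by
  have hd : ∀ τ : ℝ, HasDerivAt (fun τ : ℝ => f (x + τ • v)) (fderiv ℝ f (x + τ • v) v) τ := by
    intro τ
    have h1 : HasDerivAt (fun τ : ℝ => x + τ • v) v τ := by
      simpa using ((hasDerivAt_id τ).smul_const v).const_add x
    exact ((hf.differentiable one_ne_zero) _).hasFDerivAt.comp_hasDerivAt τ h1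
  have hcd : Continuous fun τ : ℝ => fderiv ℝ f (x + τ • v) v :=
    ((hf.continuous_fderiv one_ne_zero).comp (by fun_prop)).clm_apply continuous_const
  have hI := intervalIntegral.integral_eq_sub_of_hasDerivAt (fun τ _ => hd τ)
    (hcd.intervalIntegrable 0 s)
  simp only [zero_smul, add_zero] at hI
  rw [← hI, intervalIntegral.integral_of_le hs.1.le]
  refine (enorm_integral_le_lintegral_enorm _).trans ?_
  refine (lintegral_mono_set (Ioc_subset_Ioc_right hs.2)).trans ?_
  refine lintegral_mono fun τ => ?_
  exact ContinuousLinearMap.le_opENorm _ _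

theorem enorm_le_lintegral_segment {f : E3 → ℝ} (hf : ContDiff ℝ 1 f) (x v : E3) :
    ‖f x‖ₑ ≤ ∫⁻ s in Ioc (0 : ℝ) 1,
      (‖f (x + s • v)‖ₑ + ‖fderiv ℝ f (x + s • v)‖ₑ * ‖v‖ₑ) := by
  set D := ∫⁻ τ in Ioc (0 : ℝ) 1, ‖fderiv ℝ f (x + τ • v)‖ₑ * ‖v‖ₑ with hD
  have hm : Measurable fun s : ℝ => ‖f (x + s • v)‖ₑ :=
    (hf.continuous.comp (by fun_prop)).enorm.measurable
  rw [lintegral_add_left hm, ← hD]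
  have h1 : ∫⁻ _ in Ioc (0 : ℝ) 1, ‖f x‖ₑ = ‖f x‖ₑ := by simp
  have h2 : ∫⁻ _ in Ioc (0 : ℝ) 1, D = D := by simp
  rw [← h1, ← h2, ← lintegral_add_left hm]
  refine setLIntegral_mono' measurableSet_Ioc fun s hs => ?_
  have h3 := enorm_sub_le_lintegral_fderiv hf x v hs
  calc ‖f x‖ₑ = ‖f (x + s • v) - (f (x + s • v) - f x)‖ₑ := by congr 1; ring
    _ ≤ ‖f (x + s • v)‖ₑ + ‖f (x + s • v) - f x‖ₑ := enorm_sub_le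
    _ ≤ _ := by gcongr

theorem lintegral_rpow_le_of_translates_mem (b : Module.Basis (Fin 3) ℝ E3) :
    ∃ C : ℝ≥0, ∀ f : E3 → ℝ, ContDiff ℝ 1 f →
      ∫⁻ x in {x ∈ Metric.ball (0 : E3) 1 | ∀ i, x + b i ∈ Metric.ball (0 : E3) 1},
          ‖f x‖ₑ ^ ((3 : ℝ) / 2) ≤
        C * (∫⁻ x in Metric.ball (0 : E3) 1, (‖f x‖ₑ + ‖fderiv ℝ f x‖ₑ)) ^ ((3 : ℝ) / 2) := by
  obtain ⟨C, hC⟩ := lintegral_prod_lintegral_line_le b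
  set K : ℝ≥0 := 1 + ∑ i, ‖b i‖₊ with hK
  have hK1 : (1 : ℝ≥0) ≤ K := by simp [hK]
  have hKb : ∀ i, ‖b i‖₊ ≤ K := fun i =>
    (Finset.single_le_sum (f := fun i => ‖b i‖₊) (fun _ _ => zero_le)
      (Finset.mem_univ i)).trans (by simp [hK])
  refine ⟨C * K ^ ((3 : ℝ) / 2), fun f hf => ?_⟩
  set B := Metric.ball (0 : E3) 1
  set S := {x ∈ B | ∀ i, x + b i ∈ B} with hS
  have hSm : MeasurableSet S := by
    have : S = B ∩ ⋂ i, (fun x => x + b i) ⁻¹' B := by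
      ext x
      simp [hS]
    rw [this]
    exact Metric.isOpen_ball.measurableSet.inter (MeasurableSet.iInter fun i =>
      (Metric.isOpen_ball.preimage (continuous_id.add continuous_const)).measurableSet)
  set h : E3 → ℝ≥0∞ := B.indicator fun x => K * (‖f x‖ₑ + ‖fderiv ℝ f x‖ₑ) with hh
  have hgm : Measurable fun x => ‖f x‖ₑ + ‖fderiv ℝ f x‖ₑ :=
    (hf.continuous.enorm.add (hf.continuous_fderiv one_ne_zero).enorm).measurable
  have hm : Measurable h := (hgm.const_mul _).indicator Metric.isOpen_ball.measurableSet
  have hline : ∀ x ∈ S, ∀ i, ‖f x‖ₑ ≤ ∫⁻ s : ℝ, h (x + s • b i) := by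
    intro x hx i
    refine (enorm_le_lintegral_segment hf x (b i)).trans ?_
    rw [← lintegral_indicator measurableSet_Ioc]
    refine lintegral_mono fun s => ?_
    by_cases hs : s ∈ Ioc (0 : ℝ) 1
    swap
    · simp [hs]
    rw [indicator_of_mem hs]
    have hmem : x + s • b i ∈ B := by
      have := (convex_ball (0 : E3) 1).add_smul_mem hx.1 (hx.2 i) ⟨hs.1.le, hs.2⟩
      exact this
    rw [hh, indicator_of_mem hmem, mul_add, mul_comm _ ‖b i‖ₑ]
    gcongr
    · exact le_mul_of_one_le_left zero_le (ENNReal.coe_le_coe.mpr hK1)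
    · exact ENNReal.coe_le_coe.mpr (hKb i)
  calc ∫⁻ x in S, ‖f x‖ₑ ^ ((3 : ℝ) / 2)
      ≤ ∫⁻ x in S, ∏ i, (∫⁻ s : ℝ, h (x + s • b i)) ^ ((1 : ℝ) / 2) := by
        refine setLIntegral_mono' hSm fun x hx => ?_
        calc ‖f x‖ₑ ^ ((3 : ℝ) / 2) = ∏ _i : Fin 3, ‖f x‖ₑ ^ ((1 : ℝ) / 2) := by
              rw [Finset.prod_const, Finset.card_univ, Fintype.card_fin, ← ENNReal.rpow_natCast,
                ← ENNReal.rpow_mul]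
              norm_num
          _ ≤ _ := by
              gcongr with i
              exact hline x hx i
    _ ≤ ∫⁻ x, ∏ i, (∫⁻ s : ℝ, h (x + s • b i)) ^ ((1 : ℝ) / 2) := setLIntegral_le_lintegral _ _
    _ ≤ C * (∫⁻ x, h x) ^ ((3 : ℝ) / 2) := hC h hm
    _ = _ := by
        rw [hh, lintegral_indicator Metric.isOpen_ball.measurableSet,
          lintegral_const_mul _ hgm, ENNReal.mul_rpow_of_nonneg _ _ (by norm_num),
          ENNReal.coe_mul, ENNReal.coe_rpow_of_nonneg _ (by norm_num), mul_assoc]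

/-- Every point can be moved by the vectors of some basis into the open unit ball. -/
theorem exists_basis_add_mem_ball (x : E3) :
    ∃ b : Module.Basis (Fin 3) ℝ E3, ∀ i, x + b i ∈ Metric.ball (0 : E3) 1 := by
  have main : ∀ δ : ℝ, δ ≠ 0 → |δ| < 1 → x 0 + x 1 + x 2 ≠ δ →
      ∃ b : Module.Basis (Fin 3) ℝ E3, ∀ i, x + b i ∈ Metric.ball (0 : E3) 1 := by
    intro δ h0 h1 hx
    set v : Fin 3 → E3 := fun i => EuclideanSpace.single i δ - x
    have hli : LinearIndependent ℝ v := by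
      rw [Fintype.linearIndependent_iff]
      intro g hg
      have hj : ∀ j : Fin 3, g j * δ = (g 0 + g 1 + g 2) * x j := by
        intro j
        have := congrArg (fun y : E3 => y j) hg
        simp only [v, Fin.sum_univ_three, PiLp.add_apply, PiLp.smul_apply, PiLp.sub_apply,
          PiLp.single_apply, PiLp.zero_apply, smul_eq_mul] at this
        fin_cases j <;> simp at this ⊢ <;> linarith
      have hsum : (g 0 + g 1 + g 2) * (x 0 + x 1 + x 2 - δ) = 0 := by
        linear_combination -(hj 0) - hj 1 - hj 2
      have hs0 : g 0 + g 1 + g 2 = 0 :=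
        (mul_eq_zero.mp hsum).resolve_right (sub_ne_zero.mpr hx)
      intro i
      have := hj i
      rw [hs0, zero_mul] at this
      exact (mul_eq_zero.mp this).resolve_right h0
    refine ⟨basisOfLinearIndependentOfCardEqFinrank hli (by simp), fun i => ?_⟩
    rw [coe_basisOfLinearIndependentOfCardEqFinrank]
    simpa [v] using h1
  by_cases h : x 0 + x 1 + x 2 = 1 / 2
  · exact main (-1 / 2) (by norm_num) (by norm_num [abs_lt]) (by rw [h]; norm_num)
  · exact main (1 / 2) (by norm_num) (by norm_num [abs_lt]) h

/-- The Sobolev inequality `W^{1,1} ⊆ L^{3/2}` on the unit ball of `ℝ³`. -/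
theorem exists_lintegral_rpow_le_unit_ball :
    ∃ C : ℝ≥0, ∀ f : E3 → ℝ, ContDiff ℝ 1 f →
      ∫⁻ x in Metric.ball (0 : E3) 1, ‖f x‖ₑ ^ ((3 : ℝ) / 2) ≤
        C * (∫⁻ x in Metric.ball (0 : E3) 1, (‖f x‖ₑ + ‖fderiv ℝ f x‖ₑ)) ^ ((3 : ℝ) / 2) := by
  set B := Metric.ball (0 : E3) 1
  choose b hb using exists_basis_add_mem_ball
  choose C hC using lintegral_rpow_le_of_translates_mem
  obtain ⟨s, hs⟩ := (isCompact_closedBall (0 : E3) 1).elim_finite_subcover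
    (fun y : E3 => ⋂ i, {x | x + b y i ∈ B})
    (fun y => isOpen_iInter_of_finite fun i =>
      Metric.isOpen_ball.preimage (continuous_id.add continuous_const))
    (fun x _ => mem_iUnion.mpr ⟨x, mem_iInter.mpr fun i => hb x i⟩)
  refine ⟨∑ y ∈ s, C (b y), fun f hf => ?_⟩
  have hsub : B ⊆ ⋃ y : s, {x ∈ B | ∀ i, x + b y i ∈ B} := by
    intro x hx
    have := hs (Metric.ball_subset_closedBall hx)
    simp only [mem_iUnion, mem_iInter, mem_ofPred_eq] at this ⊢
    obtain ⟨y, hy, h⟩ := this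
    exact ⟨⟨y, hy⟩, hx, h⟩
  calc _ ≤ ∑ y ∈ s, ∫⁻ x in {x ∈ B | ∀ i, x + b y i ∈ B}, ‖f x‖ₑ ^ ((3 : ℝ) / 2) := by
        refine (lintegral_mono_set hsub).trans ?_
        rw [← Finset.sum_coe_sort s, ← tsum_fintype (L := .unconditional _)]
        exact lintegral_iUnion_le _ _
    _ ≤ ∑ y ∈ s, C (b y) * (∫⁻ x in B, (‖f x‖ₑ + ‖fderiv ℝ f x‖ₑ)) ^ ((3 : ℝ) / 2) :=
        Finset.sum_le_sum fun y _ => hC _ f hf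
    _ = _ := by
        rw [← Finset.sum_mul]
        push_cast
        rfl

theorem lintegral_mul_le_rpow_half {α : Type*} [MeasurableSpace α] {μ : Measure α}
    {f g : α → ℝ≥0∞} (hf : AEMeasurable f μ) (hg : AEMeasurable g μ) :
    ∫⁻ x, f x * g x ∂μ ≤
      (∫⁻ x, f x ^ 2 ∂μ) ^ ((1 : ℝ) / 2) * (∫⁻ x, g x ^ 2 ∂μ) ^ ((1 : ℝ) / 2) := by
  simpa using ENNReal.lintegral_mul_le_Lp_mul_Lq μ Real.HolderConjugate.two_two hf hg

theorem sq_lintegral_le {α : Type*} [MeasurableSpace α] {μ : Measure α}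
    {f : α → ℝ≥0∞} (hf : AEMeasurable f μ) :
    (∫⁻ x, f x ∂μ) ^ 2 ≤ μ univ * ∫⁻ x, f x ^ 2 ∂μ := by
  have h := lintegral_mul_le_rpow_half (f := fun _ => 1) aemeasurable_const hf
  simp only [one_mul, one_pow, lintegral_const] at h
  calc _ ≤ (μ univ ^ ((1 : ℝ) / 2) * (∫⁻ x, f x ^ 2 ∂μ) ^ ((1 : ℝ) / 2)) ^ 2 := by gcongr
    _ = _ := by
      rw [mul_pow, ← ENNReal.rpow_mul_natCast, ← ENNReal.rpow_mul_natCast]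
      norm_num

theorem lintegral_comp_add_smul (a : E3) {s : ℝ} (hs : 0 < s) {h : E3 → ℝ≥0∞}
    (hh : Measurable h) :
    ∫⁻ x, h (a + s • x) = (ENNReal.ofReal (s ^ 3))⁻¹ * ∫⁻ x, h x := by
  have h1 : ∫⁻ x, h (a + s • x) = ∫⁻ x, h (a + x) ∂(Measure.map (s • ·) volume) := by
    rw [lintegral_map (f := fun x => h (a + x)) (hh.comp (measurable_const_add a))
      (measurable_const_smul s)]
  rw [h1, Measure.map_addHaar_smul _ hs.ne', lintegral_smul_measure,
    lintegral_add_left_eq_self]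
  simp only [finrank_euclideanSpace, Fintype.card_fin, smul_eq_mul]
  rw [abs_of_pos (by positivity), ENNReal.ofReal_inv_of_pos (by positivity)]

theorem lintegral_comp_add_smul_le (a : E3) {s : ℝ} (hs : 1 / 2 ≤ s) {h : E3 → ℝ≥0∞}
    (hh : Measurable h) :
    ∫⁻ x, h (a + s • x) ≤ 8 * ∫⁻ x, h x := by
  rw [lintegral_comp_add_smul a (by linarith) hh]
  gcongr
  rw [ENNReal.inv_le_iff_inv_le, ← ENNReal.ofReal_ofNat, ← ENNReal.ofReal_inv_of_pos (by norm_num)]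
  refine ENNReal.ofReal_le_ofReal ?_
  calc (8 : ℝ)⁻¹ = (1 / 2) ^ 3 := by norm_num
    _ ≤ s ^ 3 := by gcongr

theorem lintegral_lintegral_segment_le (S : Set E3) (s : ℝ)
    {h : E3 → ℝ≥0∞} (hh : Measurable h) :
    ∫⁻ x in S, ∫⁻ y in S, h (y + s • (x - y)) ≤ 8 * volume S * ∫⁻ x, h x := by
  have hconst : ∫⁻ _ in S, 8 * ∫⁻ x, h x = 8 * volume S * ∫⁻ x, h x := by
    rw [setLIntegral_const]
    ring
  rw [← hconst]
  rcases le_total s (1 / 2) with h2 | h2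
  · refine lintegral_mono fun x => ?_
    refine (setLIntegral_le_lintegral _ _).trans ?_
    refine le_trans (le_of_eq ?_) (lintegral_comp_add_smul_le (s • x) (s := 1 - s)
      (by linarith) hh)
    refine lintegral_congr fun y => ?_
    congr 1
    module
  · rw [lintegral_lintegral_swap]
    · refine lintegral_mono fun y => ?_
      refine (setLIntegral_le_lintegral _ _).trans ?_
      refine le_trans (le_of_eq ?_) (lintegral_comp_add_smul_le ((1 - s) • y) h2 hh)
      refine lintegral_congr fun x => ?_
      congr 1
      module
    · refine (hh.comp ?_).aemeasurable
      fun_prop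

/-- Poincaré inequality on the unit ball, in double integral form. -/
theorem lintegral_lintegral_sq_sub_le {v : E3 → ℝ} (hv : ContDiff ℝ 1 v) :
    ∫⁻ x in Metric.ball (0 : E3) 1, ∫⁻ y in Metric.ball (0 : E3) 1, ‖v x - v y‖ₑ ^ 2 ≤
      32 * volume (Metric.ball (0 : E3) 1) *
        ∫⁻ x in Metric.ball (0 : E3) 1, ‖fderiv ℝ v x‖ₑ ^ 2 := by
  set B := Metric.ball (0 : E3) 1
  have hBm : MeasurableSet B := Metric.isOpen_ball.measurableSet
  set h : E3 → ℝ≥0∞ := B.indicator fun x => ‖fderiv ℝ v x‖ₑ ^ 2 with hh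
  have hd : Measurable fun x => ‖fderiv ℝ v x‖ₑ := (hv.continuous_fderiv one_ne_zero).enorm.measurable
  have hm : Measurable h := (hd.pow_const _).indicator hBm
  have hpt : ∀ x ∈ B, ∀ y ∈ B, ‖v x - v y‖ₑ ^ 2 ≤
      4 * ∫⁻ s in Ioc (0 : ℝ) 1, h (y + s • (x - y)) := by
    intro x hx y hy
    have h1 := enorm_sub_le_lintegral_fderiv hv y (x - y) (s := 1) (by simp)
    have hxy : ‖x - y‖ₑ ≤ 2 := by
      rw [← ofReal_norm]
      refine ENNReal.ofReal_le_ofNat.mpr ?_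
      have := mem_ball_zero_iff.mp hx
      have := mem_ball_zero_iff.mp hy
      linarith [norm_sub_le x y]
    have h2 : ∫⁻ τ in Ioc (0 : ℝ) 1, ‖fderiv ℝ v (y + τ • (x - y))‖ₑ ^ 2 =
        ∫⁻ s in Ioc (0 : ℝ) 1, h (y + s • (x - y)) := by
      refine setLIntegral_congr_fun measurableSet_Ioc fun s hs => ?_
      have hmem : y + s • (x - y) ∈ B :=
        (convex_ball (0 : E3) 1).add_smul_sub_mem hy hx ⟨hs.1.le, hs.2⟩
      simp only [hh, indicator_of_mem hmem]
    have hdl : Measurable fun τ : ℝ => ‖fderiv ℝ v (y + τ • (x - y))‖ₑ := hd.comp (by fun_prop)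
    rw [one_smul, add_sub_cancel, lintegral_mul_const _ hdl] at h1
    calc ‖v x - v y‖ₑ ^ 2
        ≤ ((∫⁻ τ in Ioc (0 : ℝ) 1, ‖fderiv ℝ v (y + τ • (x - y))‖ₑ) * 2) ^ 2 := by
          gcongr
          exact h1.trans (by gcongr)
      _ = 4 * (∫⁻ τ in Ioc (0 : ℝ) 1, ‖fderiv ℝ v (y + τ • (x - y))‖ₑ) ^ 2 := by
          rw [mul_pow, mul_comm]
          norm_num
      _ ≤ _ := by
          rw [← h2]
          gcongr
          refine (sq_lintegral_le hdl.aemeasurable).trans ?_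
          simp
  calc _ ≤ ∫⁻ x in B, ∫⁻ y in B, 4 * ∫⁻ s in Ioc (0 : ℝ) 1, h (y + s • (x - y)) :=
        setLIntegral_mono' hBm fun x hx => setLIntegral_mono' hBm fun y hy => hpt x hx y hy
    _ = 4 * ∫⁻ s in Ioc (0 : ℝ) 1, ∫⁻ x in B, ∫⁻ y in B, h (y + s • (x - y)) := by
        have e1 : ∀ x : E3, ∫⁻ y in B, 4 * ∫⁻ s in Ioc (0 : ℝ) 1, h (y + s • (x - y)) =
            4 * ∫⁻ s in Ioc (0 : ℝ) 1, ∫⁻ y in B, h (y + s • (x - y)) := by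
          intro x
          rw [lintegral_const_mul, lintegral_lintegral_swap]
          · exact (hm.comp (by fun_prop)).aemeasurable
          · exact Measurable.lintegral_prod_right'
              (f := fun p : E3 × ℝ => h (p.1 + p.2 • (x - p.1))) (hm.comp (by fun_prop))
        simp_rw [e1]
        have e2 : Measurable fun p : E3 × ℝ => ∫⁻ y in B, h (y + p.2 • (p.1 - y)) :=
          Measurable.lintegral_prod_right'
            (f := fun q : (E3 × ℝ) × E3 => h (q.2 + q.1.2 • (q.1.1 - q.2))) (hm.comp (by fun_prop))
        rw [lintegral_const_mul, lintegral_lintegral_swap]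
        · exact e2.aemeasurable
        · exact e2.lintegral_prod_right'
    _ ≤ 4 * ∫⁻ _ in Ioc (0 : ℝ) 1, 8 * volume B * ∫⁻ x, h x := by
        gcongr 4 * ?_
        exact setLIntegral_mono' measurableSet_Ioc fun s _ =>
          lintegral_lintegral_segment_le B s hm
    _ = _ := by
        rw [hh, lintegral_indicator hBm]
        simp only [setLIntegral_const, Real.volume_Ioc, sub_zero, ENNReal.ofReal_one, mul_one]
        rw [← mul_assoc, ← mul_assoc]
        norm_num

theorem sq_enorm_integral_le {α : Type*} [MeasurableSpace α] {μ : Measure α}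
    [IsProbabilityMeasure μ] {f : α → ℝ} (hf : AEStronglyMeasurable f μ) :
    ‖∫ x, f x ∂μ‖ₑ ^ 2 ≤ ∫⁻ x, ‖f x‖ₑ ^ 2 ∂μ := by
  calc _ ≤ (∫⁻ x, ‖f x‖ₑ ∂μ) ^ 2 := by
        gcongr
        exact enorm_integral_le_lintegral_enorm _
    _ ≤ _ := (sq_lintegral_le hf.enorm).trans (by simp)

theorem ENNReal_add_sq_le (a b : ℝ≥0∞) : (a + b) ^ 2 ≤ 2 * (a ^ 2 + b ^ 2) := by
  have := ENNReal.rpow_add_le_mul_rpow_add_rpow a b (p := 2) (by norm_num)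
  norm_num at this
  exact this

theorem ENNReal_add_cube_le (a b : ℝ≥0∞) : (a + b) ^ 3 ≤ 4 * (a ^ 3 + b ^ 3) := by
  have := ENNReal.rpow_add_le_mul_rpow_add_rpow a b (p := 3) (by norm_num)
  norm_num at this
  exact this

/-- Comparison of a `C¹` function on the unit ball with its mean value. -/
theorem exists_sub_const_unit_ball {v : E3 → ℝ} (hv : ContDiff ℝ 1 v) :
    ∃ a : ℝ,
      volume (Metric.ball (0 : E3) 1) * ‖a‖ₑ ^ 2 ≤
        ∫⁻ x in Metric.ball (0 : E3) 1, ‖v x‖ₑ ^ 2 ∧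
      ∫⁻ x in Metric.ball (0 : E3) 1, ‖v x - a‖ₑ ^ 2 ≤
        4 * ∫⁻ x in Metric.ball (0 : E3) 1, ‖v x‖ₑ ^ 2 ∧
      ∫⁻ x in Metric.ball (0 : E3) 1, ‖v x - a‖ₑ ^ 2 ≤
        32 * ∫⁻ x in Metric.ball (0 : E3) 1, ‖fderiv ℝ v x‖ₑ ^ 2 := by
  set B := Metric.ball (0 : E3) 1
  set β := volume B with hβ
  have hβ0 : β ≠ 0 := (Metric.measure_ball_pos volume _ one_pos).ne'
  have hβt : β ≠ ∞ := measure_ball_lt_top.ne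
  set ν : Measure E3 := β⁻¹ • volume.restrict B with hν
  have : IsProbabilityMeasure ν := ⟨by
    simp [hν, ENNReal.inv_mul_cancel hβ0 hβt, ← hβ]⟩
  have hνl : ∀ g : E3 → ℝ≥0∞, ∫⁻ x in B, g x = β * ∫⁻ x, g x ∂ν := by
    intro g
    rw [hν, lintegral_smul_measure, smul_eq_mul, ← mul_assoc, ENNReal.mul_inv_cancel hβ0 hβt,
      one_mul]
  have hvi : Integrable v ν := by
    refine Integrable.smul_measure ?_ (by simpa using hβ0)
    exact (hv.continuous.continuousOn.integrableOn_compact (isCompact_closedBall _ _)).mono_set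
      Metric.ball_subset_closedBall
  have hvm : Measurable v := hv.continuous.measurable
  set a := ∫ x, v x ∂ν with ha
  have ha2 : ‖a‖ₑ ^ 2 ≤ ∫⁻ x, ‖v x‖ₑ ^ 2 ∂ν := sq_enorm_integral_le hvi.aestronglyMeasurable
  refine ⟨a, ?_, ?_, ?_⟩
  · rw [hνl]
    gcongr
  · rw [hνl, hνl (fun x => ‖v x‖ₑ ^ 2), mul_left_comm]
    gcongr
    calc ∫⁻ x, ‖v x - a‖ₑ ^ 2 ∂ν ≤ ∫⁻ x, 2 * (‖v x‖ₑ ^ 2 + ‖a‖ₑ ^ 2) ∂ν := by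
          refine lintegral_mono fun x => ?_
          refine le_trans ?_ (ENNReal_add_sq_le _ _)
          gcongr
          exact enorm_sub_le
      _ = 2 * (∫⁻ x, ‖v x‖ₑ ^ 2 ∂ν + ‖a‖ₑ ^ 2) := by
          rw [lintegral_const_mul _ (by fun_prop), lintegral_add_left (by fun_prop)]
          simp
      _ ≤ 2 * (∫⁻ x, ‖v x‖ₑ ^ 2 ∂ν + ∫⁻ x, ‖v x‖ₑ ^ 2 ∂ν) := by gcongr
      _ = _ := by ring
  · have hpt : ∀ x, ‖v x - a‖ₑ ^ 2 ≤ ∫⁻ y, ‖v x - v y‖ₑ ^ 2 ∂ν := by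
      intro x
      have : v x - a = ∫ y, (v x - v y) ∂ν := by
        rw [integral_sub (integrable_const _) hvi]
        simp [ha]
      rw [this]
      exact sq_enorm_integral_le (by fun_prop)
    have hP : ∫⁻ x in B, ∫⁻ y in B, ‖v x - v y‖ₑ ^ 2 ≤
        32 * β * ∫⁻ x in B, ‖fderiv ℝ v x‖ₑ ^ 2 := lintegral_lintegral_sq_sub_le hv
    have e : ∀ x, ∫⁻ y in B, ‖v x - v y‖ₑ ^ 2 = β * ∫⁻ y, ‖v x - v y‖ₑ ^ 2 ∂ν := fun x => hνl _
    simp_rw [e] at hP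
    rw [lintegral_const_mul _ (by
      exact Measurable.lintegral_prod_right' (f := fun p : E3 × E3 => ‖v p.1 - v p.2‖ₑ ^ 2)
        (by fun_prop)), mul_comm 32, mul_assoc] at hP
    refine (lintegral_mono hpt).trans ?_
    exact (ENNReal.mul_le_mul_iff_right hβ0 hβt).mp hP

/-- Multiplicative Sobolev-Poincaré inequality for functions satisfying a Poincaré bound. -/
theorem exists_lintegral_cube_le_of_poincare :
    ∃ C : ℝ≥0∞, C ≠ ∞ ∧ ∀ w : E3 → ℝ, ContDiff ℝ 1 w →
      ∫⁻ x in Metric.ball (0 : E3) 1, ‖w x‖ₑ ^ 2 ≤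
        32 * ∫⁻ x in Metric.ball (0 : E3) 1, ‖fderiv ℝ w x‖ₑ ^ 2 →
      ∫⁻ x in Metric.ball (0 : E3) 1, ‖w x‖ₑ ^ 3 ≤
        C * (∫⁻ x in Metric.ball (0 : E3) 1, ‖w x‖ₑ ^ 2) ^ ((3 : ℝ) / 4) *
          (∫⁻ x in Metric.ball (0 : E3) 1, ‖fderiv ℝ w x‖ₑ ^ 2) ^ ((3 : ℝ) / 4) := by
  obtain ⟨C₀, hC₀⟩ := exists_lintegral_rpow_le_unit_ball
  set K : ℝ≥0∞ := 32 ^ ((1 : ℝ) / 2) + 2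
  have hK : K ≠ ∞ := by finiteness
  refine ⟨C₀ * K ^ ((3 : ℝ) / 2), by finiteness, fun w hw hP => ?_⟩
  set B := Metric.ball (0 : E3) 1
  set W := ∫⁻ x in B, ‖w x‖ₑ ^ 2 with hW
  set D := ∫⁻ x in B, ‖fderiv ℝ w x‖ₑ ^ 2 with hD
  have hwm : Measurable fun x => ‖w x‖ₑ := hw.continuous.enorm.measurable
  have hdm : Measurable fun x => ‖fderiv ℝ w x‖ₑ :=
    (hw.continuous_fderiv one_ne_zero).enorm.measurable
  have h := hC₀ (fun x => w x ^ 2) (hw.pow 2)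
  have e1 : ∀ x, ‖w x ^ 2‖ₑ ^ ((3 : ℝ) / 2) = ‖w x‖ₑ ^ 3 := by
    intro x
    rw [enorm_pow, ← ENNReal.rpow_natCast_mul, ← ENNReal.rpow_natCast]
    norm_num
  have e2 : ∀ x, ‖fderiv ℝ (fun x => w x ^ 2) x‖ₑ = 2 * (‖w x‖ₑ * ‖fderiv ℝ w x‖ₑ) := by
    intro x
    rw [fderiv_fun_pow 2 (hw.differentiable one_ne_zero x), enorm_smul]
    simp [enorm_mul, mul_assoc, Real.enorm_eq_ofReal_abs]
  simp_rw [e1, e2, enorm_pow] at h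
  rw [lintegral_add_left (hwm.pow_const 2), lintegral_const_mul 2 (by exact hwm.mul hdm), ← hW] at h
  have hsum : W + 2 * ∫⁻ x in B, ‖w x‖ₑ * ‖fderiv ℝ w x‖ₑ ≤
      K * (W ^ ((1 : ℝ) / 2) * D ^ ((1 : ℝ) / 2)) := by
    have h1 : W ≤ 32 ^ ((1 : ℝ) / 2) * (W ^ ((1 : ℝ) / 2) * D ^ ((1 : ℝ) / 2)) := by
      calc W = W ^ ((1 : ℝ) / 2) * W ^ ((1 : ℝ) / 2) := by
            rw [← ENNReal.rpow_add_of_nonneg _ _ (by norm_num) (by norm_num)]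
            norm_num
        _ ≤ W ^ ((1 : ℝ) / 2) * (32 * D) ^ ((1 : ℝ) / 2) := by gcongr
        _ = _ := by
            rw [ENNReal.mul_rpow_of_nonneg _ _ (by norm_num)]
            ring
    have h2 := lintegral_mul_le_rpow_half (μ := volume.restrict B) hwm.aemeasurable
      hdm.aemeasurable
    rw [add_mul]
    gcongr
  calc _ ≤ C₀ * (K * (W ^ ((1 : ℝ) / 2) * D ^ ((1 : ℝ) / 2))) ^ ((3 : ℝ) / 2) :=
        h.trans (by gcongr)
    _ = _ := by
        rw [ENNReal.mul_rpow_of_nonneg _ _ (by norm_num),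
          ENNReal.mul_rpow_of_nonneg _ _ (by norm_num), ← ENNReal.rpow_mul, ← ENNReal.rpow_mul,
          ← mul_assoc, ← mul_assoc]
        norm_num

theorem exists_lintegral_cube_le_unit_ball :
    ∃ C : ℝ≥0∞, C ≠ ∞ ∧ ∀ v : E3 → ℝ, ContDiff ℝ 1 v → ∀ γ ∈ Ioc (0 : ℝ) 1,
      ∫⁻ x in Metric.ball (0 : E3) γ, ‖v x‖ₑ ^ 3 ≤
        C * (ENNReal.ofReal (γ ^ 3) *
            (∫⁻ x in Metric.ball (0 : E3) 1, ‖v x‖ₑ ^ 2) ^ ((3 : ℝ) / 2) +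
          (∫⁻ x in Metric.ball (0 : E3) 1, ‖v x‖ₑ ^ 2) ^ ((3 : ℝ) / 4) *
            (∫⁻ x in Metric.ball (0 : E3) 1, ‖fderiv ℝ v x‖ₑ ^ 2) ^ ((3 : ℝ) / 4)) := by
  obtain ⟨C₀, hC₀t, hC₀⟩ := exists_lintegral_cube_le_of_poincare
  set B := Metric.ball (0 : E3) 1
  set β := volume B with hβ
  have hβ0 : β ≠ 0 := (Metric.measure_ball_pos volume _ one_pos).ne'
  have hβt : β ≠ ∞ := measure_ball_lt_top.ne
  set K₁ : ℝ≥0∞ := β * (β⁻¹) ^ ((3 : ℝ) / 2)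
  set K₂ : ℝ≥0∞ := C₀ * 4 ^ ((3 : ℝ) / 4)
  have hβi : β⁻¹ ≠ ∞ := ENNReal.inv_ne_top.mpr hβ0
  have hK₁ : K₁ ≠ ∞ := by finiteness
  have hK₂ : K₂ ≠ ∞ := by finiteness
  refine ⟨4 * (K₁ + K₂), by finiteness, fun v hv γ hγ => ?_⟩
  obtain ⟨a, ha, hw1, hw2⟩ := exists_sub_const_unit_ball hv
  set V := ∫⁻ x in B, ‖v x‖ₑ ^ 2
  set D := ∫⁻ x in B, ‖fderiv ℝ v x‖ₑ ^ 2 with hD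
  have hw := hC₀ (fun x => v x - a) (hv.sub contDiff_const)
  simp only [fderiv_sub_const, ← hD] at hw
  have hfirst : ∫⁻ x in Metric.ball (0 : E3) γ, ‖a‖ₑ ^ 3 ≤
      K₁ * (ENNReal.ofReal (γ ^ 3) * V ^ ((3 : ℝ) / 2)) := by
    have ha' : ‖a‖ₑ ^ 2 ≤ β⁻¹ * V := by
      rw [mul_comm, ← div_eq_mul_inv]
      exact (ENNReal.le_div_iff_mul_le (Or.inl hβ0) (Or.inl hβt)).mpr (by rwa [mul_comm])
    have hvol : volume (Metric.ball (0 : E3) γ) = ENNReal.ofReal (γ ^ 3) * β := by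
      rw [Measure.addHaar_ball _ _ hγ.1.le]
      simp [hβ, B]
    rw [setLIntegral_const, hvol]
    calc ‖a‖ₑ ^ 3 * (ENNReal.ofReal (γ ^ 3) * β)
        = (‖a‖ₑ ^ 2) ^ ((3 : ℝ) / 2) * (ENNReal.ofReal (γ ^ 3) * β) := by
          rw [← ENNReal.rpow_natCast_mul, ← ENNReal.rpow_natCast]
          norm_num
      _ ≤ (β⁻¹ * V) ^ ((3 : ℝ) / 2) * (ENNReal.ofReal (γ ^ 3) * β) := by gcongr
      _ = _ := by
          rw [ENNReal.mul_rpow_of_nonneg _ _ (by norm_num)]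
          ring
  have hsecond : ∫⁻ x in Metric.ball (0 : E3) γ, ‖v x - a‖ₑ ^ 3 ≤
      K₂ * (V ^ ((3 : ℝ) / 4) * D ^ ((3 : ℝ) / 4)) := by
    refine (lintegral_mono_set (Metric.ball_subset_ball hγ.2)).trans ((hw hw2).trans ?_)
    calc _ ≤ C₀ * (4 * V) ^ ((3 : ℝ) / 4) * D ^ ((3 : ℝ) / 4) := by gcongr
      _ = _ := by
          rw [ENNReal.mul_rpow_of_nonneg _ _ (by norm_num)]
          ring
  have hvm : Measurable v := hv.continuous.measurable
  calc ∫⁻ x in Metric.ball (0 : E3) γ, ‖v x‖ₑ ^ 3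
      ≤ ∫⁻ x in Metric.ball (0 : E3) γ, 4 * (‖v x - a‖ₑ ^ 3 + ‖a‖ₑ ^ 3) := by
        refine lintegral_mono fun x => ?_
        refine le_trans ?_ (ENNReal_add_cube_le _ _)
        gcongr
        simpa using enorm_add_le (v x - a) a
    _ = 4 * ((∫⁻ x in Metric.ball (0 : E3) γ, ‖v x - a‖ₑ ^ 3) +
          ∫⁻ x in Metric.ball (0 : E3) γ, ‖a‖ₑ ^ 3) := by
        rw [lintegral_const_mul _ (by fun_prop), lintegral_add_left (by fun_prop)]
    _ ≤ 4 * (K₂ * (V ^ ((3 : ℝ) / 4) * D ^ ((3 : ℝ) / 4)) +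
          K₁ * (ENNReal.ofReal (γ ^ 3) * V ^ ((3 : ℝ) / 2))) := by gcongr
    _ ≤ 4 * ((K₁ + K₂) * (V ^ ((3 : ℝ) / 4) * D ^ ((3 : ℝ) / 4)) +
          (K₁ + K₂) * (ENNReal.ofReal (γ ^ 3) * V ^ ((3 : ℝ) / 2))) := by
        gcongr
        · exact le_add_self
        · exact le_self_add
    _ = _ := by ring

theorem setLIntegral_ball_comp_add_smul (x₀ : E3) {ρ : ℝ} (hρ : 0 < ρ) (γ : ℝ) {h : E3 → ℝ≥0∞}
    (hh : Measurable h) :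
    ∫⁻ x in Metric.ball (0 : E3) γ, h (x₀ + ρ • x) =
      ENNReal.ofReal ρ ^ (-3 : ℝ) * ∫⁻ x in Metric.ball x₀ (γ * ρ), h x := by
  rw [← lintegral_indicator Metric.isOpen_ball.measurableSet,
    ← lintegral_indicator Metric.isOpen_ball.measurableSet]
  have h1 := lintegral_comp_add_smul x₀ hρ
    (hh.indicator (Metric.isOpen_ball (x := x₀) (ε := γ * ρ)).measurableSet)
  have e1 : (ENNReal.ofReal (ρ ^ 3))⁻¹ = ENNReal.ofReal ρ ^ (-3 : ℝ) := by
    rw [ENNReal.ofReal_pow hρ.le, ENNReal.rpow_neg]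
    norm_num
  rw [← e1, ← h1]
  refine lintegral_congr fun x => ?_
  have hiff : x₀ + ρ • x ∈ Metric.ball x₀ (γ * ρ) ↔ x ∈ Metric.ball (0 : E3) γ := by
    rw [mem_ball_iff_norm, mem_ball_zero_iff, add_sub_cancel_left, norm_smul, Real.norm_eq_abs,
      abs_of_pos hρ, mul_comm, mul_lt_mul_iff_left₀ hρ]
  by_cases hx : x ∈ Metric.ball (0 : E3) γ
  · rw [indicator_of_mem hx, indicator_of_mem (hiff.mpr hx)]
  · rw [indicator_of_notMem hx, indicator_of_notMem (fun h => hx (hiff.mp h))]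

theorem exists_lintegral_cube_le_ball :
    ∃ C : ℝ≥0∞, C ≠ ∞ ∧ ∀ v : E3 → ℝ, ContDiff ℝ 1 v → ∀ (x₀ : E3) (ρ : ℝ), 0 < ρ →
      ∀ γ ∈ Ioc (0 : ℝ) 1,
      ∫⁻ x in Metric.ball x₀ (γ * ρ), ‖v x‖ₑ ^ 3 ≤
        C * (ENNReal.ofReal (γ ^ 3) * ENNReal.ofReal ρ ^ (-(3 : ℝ) / 2) *
            (∫⁻ x in Metric.ball x₀ ρ, ‖v x‖ₑ ^ 2) ^ ((3 : ℝ) / 2) +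
          (∫⁻ x in Metric.ball x₀ ρ, ‖v x‖ₑ ^ 2) ^ ((3 : ℝ) / 4) *
            (∫⁻ x in Metric.ball x₀ ρ, ‖fderiv ℝ v x‖ₑ ^ 2) ^ ((3 : ℝ) / 4)) := by
  obtain ⟨C, hCt, hC⟩ := exists_lintegral_cube_le_unit_ball
  refine ⟨C, hCt, fun v hv x₀ ρ hρ γ hγ => ?_⟩
  have hvm : Measurable v := hv.continuous.measurable
  have hdm : Measurable fun x => ‖fderiv ℝ v x‖ₑ :=
    (hv.continuous_fderiv one_ne_zero).enorm.measurable
  have h := hC (fun x => v (x₀ + ρ • x)) (hv.comp (by fun_prop)) γ hγ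
  have hfd : ∀ x, ‖fderiv ℝ (fun x => v (x₀ + ρ • x)) x‖ₑ ^ 2 =
      ENNReal.ofReal ρ ^ 2 * ‖fderiv ℝ v (x₀ + ρ • x)‖ₑ ^ 2 := by
    intro x
    have h1 : HasFDerivAt (fun x : E3 => x₀ + ρ • x) (ρ • ContinuousLinearMap.id ℝ E3) x :=
      ((hasFDerivAt_id x).const_smul ρ).const_add x₀
    have h2 := ((hv.differentiable one_ne_zero (x₀ + ρ • x)).hasFDerivAt.comp x h1).fderiv
    have h3 : fderiv ℝ (fun x => v (x₀ + ρ • x)) x = ρ • fderiv ℝ v (x₀ + ρ • x) := by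
      rw [← Function.comp_def v, h2]
      ext y
      simp
    rw [h3, enorm_smul, mul_pow, Real.enorm_eq_ofReal hρ.le]
  simp_rw [hfd] at h
  have hdl : Measurable fun x => ‖fderiv ℝ v (x₀ + ρ • x)‖ₑ ^ 2 :=
    (hdm.pow_const 2).comp (by fun_prop)
  rw [lintegral_const_mul _ hdl,
    setLIntegral_ball_comp_add_smul x₀ hρ γ (h := fun x => ‖v x‖ₑ ^ 3) (by fun_prop),
    setLIntegral_ball_comp_add_smul x₀ hρ 1 (h := fun x => ‖v x‖ₑ ^ 2) (by fun_prop),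
    setLIntegral_ball_comp_add_smul x₀ hρ 1 (hdm.pow_const 2), one_mul] at h
  set R := ENNReal.ofReal ρ
  have hR0 : R ≠ 0 := by simpa [R] using hρ
  have hRt : R ≠ ∞ := ENNReal.ofReal_ne_top
  set V := ∫⁻ x in Metric.ball x₀ ρ, ‖v x‖ₑ ^ 2
  set D := ∫⁻ x in Metric.ball x₀ ρ, ‖fderiv ℝ v x‖ₑ ^ 2
  set I := ∫⁻ x in Metric.ball x₀ (γ * ρ), ‖v x‖ₑ ^ 3
  have hRR : ∀ a b : ℝ, R ^ a * R ^ b = R ^ (a + b) := fun a b =>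
    (ENNReal.rpow_add a b hR0 hRt).symm
  have e0 : I = R ^ (3 : ℝ) * (R ^ (-3 : ℝ) * I) := by
    rw [← mul_assoc, hRR]
    norm_num
  have e1 : R ^ (3 : ℝ) * (R ^ (-3 : ℝ) * V) ^ ((3 : ℝ) / 2) =
      R ^ (-(3 : ℝ) / 2) * V ^ ((3 : ℝ) / 2) := by
    rw [ENNReal.mul_rpow_of_nonneg _ _ (by norm_num), ← ENNReal.rpow_mul, ← mul_assoc, hRR]
    norm_num
  have e2 : R ^ (3 : ℝ) * ((R ^ (-3 : ℝ) * V) ^ ((3 : ℝ) / 4) *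
      (R ^ 2 * (R ^ (-3 : ℝ) * D)) ^ ((3 : ℝ) / 4)) =
      V ^ ((3 : ℝ) / 4) * D ^ ((3 : ℝ) / 4) := by
    have : R ^ 2 * (R ^ (-3 : ℝ) * D) = R ^ (-1 : ℝ) * D := by
      rw [← ENNReal.rpow_natCast, ← mul_assoc, hRR]
      norm_num
    rw [this, ENNReal.mul_rpow_of_nonneg _ _ (by norm_num),
      ENNReal.mul_rpow_of_nonneg _ _ (by norm_num), ← ENNReal.rpow_mul, ← ENNReal.rpow_mul,
      mul_mul_mul_comm, hRR, ← mul_assoc, hRR]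
    norm_num
  rw [e0]
  calc _ ≤ R ^ (3 : ℝ) * _ := mul_le_mul_right h _
    _ = C * (ENNReal.ofReal (γ ^ 3) * (R ^ (3 : ℝ) * (R ^ (-3 : ℝ) * V) ^ ((3 : ℝ) / 2)) +
        R ^ (3 : ℝ) * ((R ^ (-3 : ℝ) * V) ^ ((3 : ℝ) / 4) *
      (R ^ 2 * (R ^ (-3 : ℝ) * D)) ^ ((3 : ℝ) / 4))) := by ring
    _ = _ := by rw [e1, e2, ← mul_assoc]

theorem enorm_sq_le_sum (L : E3 →L[ℝ] ℝ) :
    ‖L‖ₑ ^ 2 ≤ ∑ j, ‖L (EuclideanSpace.single j 1)‖ₑ ^ 2 := by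
  set y := (InnerProductSpace.toDual ℝ E3).symm L with hy
  have hyj : ∀ j, y j = L (EuclideanSpace.single j 1) := by
    intro j
    rw [← InnerProductSpace.toDual_symm_apply (𝕜 := ℝ) (y := L), ← hy,
      EuclideanSpace.inner_single_right]
    simp
  have hn : ‖L‖ ^ 2 = ∑ j, ‖L (EuclideanSpace.single j 1)‖ ^ 2 := by
    rw [← LinearIsometryEquiv.norm_map (InnerProductSpace.toDual ℝ E3).symm L, ← hy,
      EuclideanSpace.norm_sq_eq]
    simp_rw [hyj]
  refine le_of_eq ?_
  simp_rw [← ofReal_norm, ← ENNReal.ofReal_pow (norm_nonneg _)]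
  rw [hn, ENNReal.ofReal_sum_of_nonneg (fun _ _ => by positivity)]

theorem setLIntegral_prod_symm' {S : Set E3} {I : Set ℝ} {h : SpT → ℝ≥0∞} (hh : Measurable h) :
    ∫⁻ z in S ×ˢ I, h z = ∫⁻ t in I, ∫⁻ x in S, h (x, t) := by
  rw [Measure.volume_eq_prod, ← Measure.prod_restrict, lintegral_prod_symm' _ hh]

theorem Qstar_eq (z₀ : SpT) (r : ℝ) : Qstar z₀ r = Metric.ball z₀.1 r ×ˢ Istar z₀.2 r := rfl

theorem volume_Istar (t₀ r : ℝ) : volume (Istar t₀ r) = ENNReal.ofReal (r ^ 2) := by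
  rw [Istar, Real.volume_Ioo]
  congr 1
  ring

theorem Istar_subset_Istar (t₀ : ℝ) {r s : ℝ} (hr : 0 ≤ r) (hrs : r ≤ s) :
    Istar t₀ r ⊆ Istar t₀ s := by
  have : r ^ 2 ≤ s ^ 2 := by gcongr
  exact Ioo_subset_Ioo (by linarith) (by linarith)

theorem setLIntegral_rpow_le {I : Set ℝ} {f : ℝ → ℝ≥0∞} (hf : Measurable f) :
    ∫⁻ t in I, f t ^ ((3 : ℝ) / 4) ≤
      volume I ^ ((1 : ℝ) / 4) * (∫⁻ t in I, f t) ^ ((3 : ℝ) / 4) := by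
  have hpq : Real.HolderConjugate 4 (4 / 3) := by
    rw [Real.holderConjugate_iff]
    norm_num
  have := ENNReal.lintegral_mul_le_Lp_mul_Lq (volume.restrict I) hpq
    (f := fun _ => 1) (g := fun t => f t ^ ((3 : ℝ) / 4)) aemeasurable_const
    (hf.pow_const _).aemeasurable
  simp_rw [Pi.mul_apply, one_mul, ← ENNReal.rpow_mul] at this
  norm_num at this ⊢
  exact this

/-- The space-time estimate for smooth functions. -/
theorem exists_lintegral_cube_le_Qstar :
    ∃ C : ℝ≥0∞, C ≠ ∞ ∧ ∀ F : SpT → ℝ, ContDiff ℝ 1 F → ∀ (z₀ : SpT) (ρ : ℝ), 0 < ρ →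
      ∀ γ ∈ Ioc (0 : ℝ) 1, ∀ M : ℝ≥0∞,
      (∀ t ∈ Istar z₀.2 ρ, ∫⁻ x in Metric.ball z₀.1 ρ, ‖F (x, t)‖ₑ ^ 2 ≤ M) →
      ∫⁻ z in Qstar z₀ (γ * ρ), ‖F z‖ₑ ^ 3 ≤
        C * (ENNReal.ofReal (γ ^ 3) * ENNReal.ofReal ρ ^ (-(3 : ℝ) / 2) * M ^ ((3 : ℝ) / 2) *
              ENNReal.ofReal ((γ * ρ) ^ 2) +
          M ^ ((3 : ℝ) / 4) * (ENNReal.ofReal ((γ * ρ) ^ 2) ^ ((1 : ℝ) / 4) *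
            (∫⁻ z in Qstar z₀ ρ, ∑ j, ‖sderiv j F z‖ₑ ^ 2) ^ ((3 : ℝ) / 4))) := by
  obtain ⟨C, hCt, hC⟩ := exists_lintegral_cube_le_ball
  refine ⟨C, hCt, fun F hF z₀ ρ hρ γ hγ M hM => ?_⟩
  have hFm : Measurable F := hF.continuous.measurable
  have hγρ : γ * ρ ≤ ρ := mul_le_of_le_one_left hρ.le hγ.2
  have hγρ0 : 0 ≤ γ * ρ := mul_nonneg hγ.1.le hρ.le
  have hdm : Measurable fun z => ∑ j, ‖sderiv j F z‖ₑ ^ 2 := by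
    refine Finset.measurable_sum _ fun j _ => Measurable.pow_const ?_ _
    exact (((hF.continuous_fderiv one_ne_zero).clm_apply continuous_const).enorm).measurable
  have hI := Istar_subset_Istar z₀.2 hγρ0 hγρ
  have hslice : ∀ t, ContDiff ℝ 1 fun x : E3 => F (x, t) := fun t => hF.comp (by fun_prop)
  have hfd : ∀ (t : ℝ) (x : E3),
      ‖fderiv ℝ (fun x : E3 => F (x, t)) x‖ₑ ^ 2 ≤ ∑ j, ‖sderiv j F (x, t)‖ₑ ^ 2 := by
    intro t x
    refine (enorm_sq_le_sum _).trans (le_of_eq ?_)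
    refine Finset.sum_congr rfl fun j _ => ?_
    have h1 : HasFDerivAt (fun x : E3 => (x, t)) (ContinuousLinearMap.inl ℝ E3 ℝ) x :=
      hasFDerivAt_prodMk_left x t
    have h2 := ((hF.differentiable one_ne_zero (x, t)).hasFDerivAt.comp x h1).fderiv
    rw [Function.comp_def] at h2
    rw [h2]
    simp [sderiv]
  set N : ℝ → ℝ≥0∞ := fun t => ∫⁻ x in Metric.ball z₀.1 ρ, ∑ j, ‖sderiv j F (x, t)‖ₑ ^ 2 with hN
  have hNm : Measurable N :=
    Measurable.lintegral_prod_left' (f := fun p : SpT => ∑ j, ‖sderiv j F p‖ₑ ^ 2) hdm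
  set K := ENNReal.ofReal (γ ^ 3) * ENNReal.ofReal ρ ^ (-(3 : ℝ) / 2)
  calc ∫⁻ z in Qstar z₀ (γ * ρ), ‖F z‖ₑ ^ 3
      = ∫⁻ t in Istar z₀.2 (γ * ρ), ∫⁻ x in Metric.ball z₀.1 (γ * ρ), ‖F (x, t)‖ₑ ^ 3 := by
        rw [Qstar_eq, setLIntegral_prod_symm' (by fun_prop)]
    _ ≤ ∫⁻ t in Istar z₀.2 (γ * ρ), C * (K * M ^ ((3 : ℝ) / 2) +
          M ^ ((3 : ℝ) / 4) * N t ^ ((3 : ℝ) / 4)) := by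
        refine setLIntegral_mono' measurableSet_Ioo fun t ht => ?_
        refine (hC _ (hslice t) z₀.1 ρ hρ γ hγ).trans ?_
        have := hM t (hI ht)
        gcongr
        exact lintegral_mono fun x => hfd t x
    _ = C * (K * M ^ ((3 : ℝ) / 2) * ENNReal.ofReal ((γ * ρ) ^ 2) +
          M ^ ((3 : ℝ) / 4) * ∫⁻ t in Istar z₀.2 (γ * ρ), N t ^ ((3 : ℝ) / 4)) := by
        have hNp := hNm.pow_const ((3 : ℝ) / 4)
        rw [lintegral_const_mul _ (by exact (hNp.const_mul _).const_add _),
          lintegral_add_left measurable_const, lintegral_const_mul (M ^ ((3 : ℝ) / 4)) hNp,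
          setLIntegral_const, volume_Istar]
    _ ≤ _ := by
        gcongr
        refine (setLIntegral_rpow_le hNm).trans ?_
        rw [volume_Istar, Qstar_eq, setLIntegral_prod_symm' hdm]
        gcongr

instance isAddHaarMeasure_volume_SpT : (volume : Measure SpT).IsAddHaarMeasure :=
  inferInstanceAs ((volume : Measure E3).prod (volume : Measure ℝ)).IsAddHaarMeasure

open scoped Convolution in
theorem sq_enorm_convolution_le (φ : ContDiffBump (0 : SpT)) {F : SpT → ℝ} (hF : Measurable F)
    (z : SpT) :
    ‖(F ⋆[ContinuousLinearMap.mul ℝ ℝ, volume] φ.normed volume) z‖ₑ ^ 2 ≤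
      ∫⁻ w, ‖F (z - w)‖ₑ ^ 2 ∂(volume.withDensity fun w => ENNReal.ofReal (φ.normed volume w)) := by
  have hm : Measurable fun w => ENNReal.ofReal (φ.normed volume w) :=
    (φ.continuous_normed (μ := volume)).measurable.ennreal_ofReal
  have hFz : Measurable fun w => ‖F (z - w)‖ₑ := by fun_prop
  set ν := volume.withDensity fun w => ENNReal.ofReal (φ.normed volume w) with hν
  have h1 : ν univ = 1 := by
    rw [hν, withDensity_apply _ MeasurableSet.univ, Measure.restrict_univ,
      ← ofReal_integral_eq_lintegral_ofReal φ.integrable_normed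
        (Eventually.of_forall φ.nonneg_normed), φ.integral_normed, ENNReal.ofReal_one]
  have h2 : ‖(F ⋆[ContinuousLinearMap.mul ℝ ℝ, volume] φ.normed volume) z‖ₑ ≤
      ∫⁻ w, ‖F (z - w)‖ₑ ∂ν := by
    rw [convolution_mul_swap, hν, lintegral_withDensity_eq_lintegral_mul _ hm hFz]
    refine (enorm_integral_le_lintegral_enorm _).trans (le_of_eq (lintegral_congr fun w => ?_))
    rw [enorm_mul, Pi.mul_apply, Real.enorm_eq_ofReal (φ.nonneg_normed w), mul_comm]
  calc _ ≤ (∫⁻ w, ‖F (z - w)‖ₑ ∂ν) ^ 2 := by gcongr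
    _ ≤ _ := by simpa [h1] using sq_lintegral_le (μ := ν) hFz.aemeasurable

open scoped Convolution in
theorem lintegral_sq_convolution_le (φ : ContDiffBump (0 : SpT)) {F : SpT → ℝ}
    (hF : Measurable F) :
    ∫⁻ z, ‖(F ⋆[ContinuousLinearMap.mul ℝ ℝ, volume] φ.normed volume) z‖ₑ ^ 2 ≤
      ∫⁻ z, ‖F z‖ₑ ^ 2 := by
  have hm : Measurable fun w => ENNReal.ofReal (φ.normed volume w) :=
    (φ.continuous_normed (μ := volume)).measurable.ennreal_ofReal
  refine (lintegral_mono fun z => sq_enorm_convolution_le φ hF z).trans ?_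
  rw [lintegral_lintegral_swap (by fun_prop)]
  have h1 : ∀ w : SpT, ∫⁻ z, ‖F (z - w)‖ₑ ^ 2 = ∫⁻ z, ‖F z‖ₑ ^ 2 := fun w =>
    lintegral_sub_right_eq_self (fun z => ‖F z‖ₑ ^ 2) w
  simp_rw [h1]
  rw [lintegral_const, withDensity_apply _ MeasurableSet.univ, Measure.restrict_univ,
    ← ofReal_integral_eq_lintegral_ofReal φ.integrable_normed
      (Eventually.of_forall φ.nonneg_normed), φ.integral_normed, ENNReal.ofReal_one, mul_one]

open scoped Convolution in
theorem lintegral_sq_convolution_slice_le (φ : ContDiffBump (0 : SpT)) {F : SpT → ℝ}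
    (hF : Measurable F) {M : ℝ≥0∞} (hM : ∀ᵐ t : ℝ, ∫⁻ x : E3, ‖F (x, t)‖ₑ ^ 2 ≤ M) (t : ℝ) :
    ∫⁻ x : E3, ‖(F ⋆[ContinuousLinearMap.mul ℝ ℝ, volume] φ.normed volume) (x, t)‖ₑ ^ 2 ≤ M := by
  have hm : Measurable fun w => ENNReal.ofReal (φ.normed volume w) :=
    (φ.continuous_normed (μ := volume)).measurable.ennreal_ofReal
  refine (lintegral_mono fun x => sq_enorm_convolution_le φ hF (x, t)).trans ?_
  rw [lintegral_lintegral_swap (by fun_prop)]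
  have h1 : ∀ w : SpT, ∫⁻ x : E3, ‖F ((x, t) - w)‖ₑ ^ 2 = ∫⁻ x : E3, ‖F (x, t - w.2)‖ₑ ^ 2 :=
    fun w => lintegral_sub_right_eq_self (fun x : E3 => ‖F (x, t - w.2)‖ₑ ^ 2) w.1
  simp_rw [h1]
  have h2 : ∀ᵐ s : ℝ, ∫⁻ x : E3, ‖F (x, t - s)‖ₑ ^ 2 ≤ M :=
    (Measure.measurePreserving_sub_left volume t).quasiMeasurePreserving.ae hM
  have h3 : ∀ᵐ w : SpT, ∫⁻ x : E3, ‖F (x, t - w.2)‖ₑ ^ 2 ≤ M := by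
    rw [Measure.volume_eq_prod]
    exact Measure.quasiMeasurePreserving_snd.ae h2
  refine (lintegral_mono_ae ((withDensity_absolutelyContinuous _ _).ae_le h3)).trans ?_
  rw [lintegral_const, withDensity_apply _ MeasurableSet.univ, Measure.restrict_univ,
    ← ofReal_integral_eq_lintegral_ofReal φ.integrable_normed
      (Eventually.of_forall φ.nonneg_normed), φ.integral_normed, ENNReal.ofReal_one, mul_one]

open scoped Convolution in
theorem sderiv_convolution_eq (φ : ContDiffBump (0 : SpT)) {U Q : Set SpT} (hQU : Q ⊆ U)
    {f : SpT → ℝ} {g : Fin 3 → SpT → ℝ} (hfg : WeakSGrad U f g)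
    (hf : LocallyIntegrable (Q.indicator f)) {z : SpT}
    (hz : Metric.closedBall z φ.rOut ⊆ Q) (j : Fin 3) :
    sderiv j (Q.indicator f ⋆[ContinuousLinearMap.mul ℝ ℝ, volume] φ.normed volume) z =
      (Q.indicator (g j) ⋆[ContinuousLinearMap.mul ℝ ℝ, volume] φ.normed volume) z := by
  set η : SpT → ℝ := φ.normed volume with hη
  have hηs : ContDiff ℝ (⊤ : ℕ∞) η := φ.contDiff_normed
  have hηc : HasCompactSupport η := φ.hasCompactSupport_normed
  set ψ : SpT → ℝ := fun w => η (z - w) with hψ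
  have hψQ : tsupport ψ ⊆ Q := by
    refine (closure_minimal (fun w hw => ?_) Metric.isClosed_closedBall).trans hz
    have : z - w ∈ Function.support η := hw
    rw [hη, φ.support_normed_eq, mem_ball_zero_iff] at this
    rw [Metric.mem_closedBall, dist_comm, dist_eq_norm]
    exact this.le
  have hψt : IsTestOn U ψ := by
    refine ⟨hηs.comp (by fun_prop), ?_, hψQ.trans hQU⟩
    exact hηc.comp_homeomorph (Homeomorph.subLeft z)
  have hψd : ∀ w, sderiv j ψ w = - sderiv j η (z - w) := by
    intro w
    have h1 : HasFDerivAt (fun w : SpT => z - w) (-ContinuousLinearMap.id ℝ SpT) w :=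
      (hasFDerivAt_id w).const_sub z
    have h2 := ((hηs.differentiable (by simp) (z - w)).hasFDerivAt.comp w h1).fderiv
    rw [Function.comp_def] at h2
    simp only [sderiv, hψ]
    rw [h2]
    simp
  have hψd0 : ∀ w, w ∉ Q → sderiv j ψ w = 0 := by
    intro w hw
    have : fderiv ℝ ψ w = 0 := by
      by_contra h
      exact hw (hψQ (support_fderiv_subset ℝ h))
    rw [sderiv, this]
    simp
  have hψ0 : ∀ w, w ∉ Q → ψ w = 0 := fun w hw =>
    image_eq_zero_of_notMem_tsupport fun h => hw (hψQ h)
  have key := hfg j ψ hψt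
  rw [setIntegral_eq_integral_of_forall_compl_eq_zero
      (fun w hw => by rw [hψd0 w fun h => hw (hQU h), mul_zero]),
    setIntegral_eq_integral_of_forall_compl_eq_zero
      (fun w hw => by rw [hψ0 w fun h => hw (hQU h), mul_zero])] at key
  rw [sderiv, (hηc.hasFDerivAt_convolution_right (ContinuousLinearMap.mul ℝ ℝ) hf (hηs.of_le (by simp)) z).fderiv,
    convolution_precompR_apply _ hf (hηc.fderiv ℝ) (hηs.continuous_fderiv (by simp)),
    convolution_mul, convolution_mul]
  have e1 : ∀ w, Q.indicator f w * fderiv ℝ η (z - w) (EuclideanSpace.single j 1, 0) =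
      -(f w * sderiv j ψ w) := by
    intro w
    by_cases hw : w ∈ Q
    · rw [indicator_of_mem hw, hψd, sderiv]
      ring
    · rw [indicator_of_notMem hw, hψd0 w hw]
      simp
  have e2 : ∀ w, Q.indicator (g j) w * η (z - w) = g j w * ψ w := by
    intro w
    by_cases hw : w ∈ Q
    · rw [indicator_of_mem hw]
    · rw [indicator_of_notMem hw, hψ0 w hw]
      simp
  simp_rw [e1, e2]
  rw [integral_neg, key, neg_neg]

theorem Qstar_subset_Qstar (z₀ : SpT) {r s : ℝ} (hr : 0 ≤ r) (hrs : r ≤ s) :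
    Qstar z₀ r ⊆ Qstar z₀ s :=
  prod_mono (Metric.ball_subset_ball hrs) (Istar_subset_Istar z₀.2 hr hrs)

theorem isOpen_Qstar (z₀ : SpT) (r : ℝ) : IsOpen (Qstar z₀ r) :=
  Metric.isOpen_ball.prod isOpen_Ioo

theorem volume_Qstar_ne_top (z₀ : SpT) (r : ℝ) : volume (Qstar z₀ r) ≠ ∞ := by
  rw [Qstar_eq, Measure.volume_eq_prod, Measure.prod_prod, volume_Istar]
  exact ENNReal.mul_ne_top measure_ball_lt_top.ne ENNReal.ofReal_ne_top

/-- A smaller cylinder stays inside a larger one under a small thickening. -/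
theorem exists_closedBall_subset_Qstar (z₀ : SpT) {r s : ℝ} (hr : 0 ≤ r) (hrs : r < s) {δ : ℝ}
    (hδ : 0 < δ) :
    ∃ ε > 0, ε ≤ δ ∧ ∀ z ∈ Qstar z₀ r, Metric.closedBall z ε ⊆ Qstar z₀ s := by
  have hsq : r ^ 2 < s ^ 2 := by gcongr
  refine ⟨min δ (min (s - r) ((s ^ 2 - r ^ 2) / 8)), ?_, min_le_left _ _, fun z hz w hw => ?_⟩
  · have : 0 < s - r := by linarith
    have : 0 < (s ^ 2 - r ^ 2) / 8 := by linarith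
    positivity
  set ε := min δ (min (s - r) ((s ^ 2 - r ^ 2) / 8))
  have h1 : ε ≤ s - r := (min_le_right _ _).trans (min_le_left _ _)
  have h2 : ε ≤ (s ^ 2 - r ^ 2) / 8 := (min_le_right _ _).trans (min_le_right _ _)
  have hz1 : dist z.1 z₀.1 < r := hz.1
  have hz2 : z.2 ∈ Ioo _ _ := hz.2
  rw [Metric.mem_closedBall, Prod.dist_eq, max_le_iff, Real.dist_eq, abs_le] at hw
  refine ⟨?_, ?_, ?_⟩
  · have := dist_triangle w.1 z.1 z₀.1
    change dist w.1 z₀.1 < s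
    linarith [hw.1]
  · linarith [hz2.1, hw.2.1]
  · linarith [hz2.2, hw.2.2]

theorem integrableOn_Qstar {f : SpT → ℝ} (hf : Measurable f) {z₀ : SpT} {ρ : ℝ} {M : ℝ≥0∞}
    (hMt : M ≠ ∞)
    (hM : ∀ᵐ t ∂(volume.restrict (Istar z₀.2 ρ)), ∫⁻ x in ball3 z₀.1 ρ, ‖f (x, t)‖ₑ ^ 2 ≤ M) :
    IntegrableOn f (Qstar z₀ ρ) := by
  refine ⟨hf.aestronglyMeasurable, ?_⟩
  have h1 : ∫⁻ z in Qstar z₀ ρ, ‖f z‖ₑ ^ 2 ≤ M * ENNReal.ofReal (ρ ^ 2) := by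
    rw [Qstar_eq, setLIntegral_prod_symm' (by fun_prop), ← volume_Istar z₀.2 ρ,
      ← setLIntegral_const]
    exact lintegral_mono_ae hM
  have h2 := sq_lintegral_le (μ := volume.restrict (Qstar z₀ ρ)) hf.enorm.aemeasurable
  rw [Measure.restrict_apply_univ] at h2
  have h3 : (∫⁻ z in Qstar z₀ ρ, ‖f z‖ₑ) ^ 2 < ∞ :=
    h2.trans_lt (ENNReal.mul_lt_top (volume_Qstar_ne_top z₀ ρ).lt_top
      (h1.trans_lt (ENNReal.mul_lt_top hMt.lt_top ENNReal.ofReal_lt_top)))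
  exact (ENNReal.pow_lt_top_iff.mp h3).resolve_right two_ne_zero

open scoped Convolution in
theorem measurable_convolution (φ : ContDiffBump (0 : SpT)) {F : SpT → ℝ} (hF : Measurable F) :
    Measurable (F ⋆[ContinuousLinearMap.mul ℝ ℝ, volume] φ.normed volume) := by
  have hη : Measurable (φ.normed volume) := φ.continuous_normed.measurable
  have h : StronglyMeasurable fun z : SpT => ∫ w, F (z - w) * φ.normed volume w :=
    StronglyMeasurable.integral_prod_right
      (f := fun z w : SpT => F (z - w) * φ.normed volume w) (by
        refine Measurable.stronglyMeasurable ?_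
        unfold Function.uncurry
        fun_prop)
  have e : (F ⋆[ContinuousLinearMap.mul ℝ ℝ, volume] φ.normed volume) =
      fun z => ∫ w, F (z - w) * φ.normed volume w := funext fun z => convolution_mul_swap
  rw [e]
  exact h.measurable

open scoped Convolution in
theorem exists_lintegral_cube_le_of_weakSGrad :
    ∃ C : ℝ≥0∞, C ≠ ∞ ∧ ∀ (U : Set SpT) (f : SpT → ℝ) (g : Fin 3 → SpT → ℝ), Measurable f →
      (∀ j, Measurable (g j)) → WeakSGrad U f g → ∀ (z₀ : SpT) (ρ : ℝ), 0 < ρ →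
      Qstar z₀ ρ ⊆ U → ∀ γ ∈ Ioc (0 : ℝ) 1, ∀ M : ℝ≥0∞, M ≠ ∞ →
      (∀ᵐ t ∂(volume.restrict (Istar z₀.2 ρ)),
        ∫⁻ x in ball3 z₀.1 ρ, ‖f (x, t)‖ₑ ^ 2 ≤ M) →
      ∫⁻ z in Qstar z₀ (γ * ρ), ‖f z‖ₑ ^ 3 ≤
        C * (ENNReal.ofReal (γ ^ 3) * ENNReal.ofReal ρ ^ (-(3 : ℝ) / 2) * M ^ ((3 : ℝ) / 2) *
              ENNReal.ofReal ((γ * ρ) ^ 2) +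
          M ^ ((3 : ℝ) / 4) * (ENNReal.ofReal ((γ * ρ) ^ 2) ^ ((1 : ℝ) / 4) *
            (∫⁻ z in Qstar z₀ ρ, ∑ j, ‖g j z‖ₑ ^ 2) ^ ((3 : ℝ) / 4))) := by
  obtain ⟨C, hCt, hC⟩ := exists_lintegral_cube_le_Qstar
  refine ⟨C * 4, ENNReal.mul_ne_top hCt (by norm_num),
    fun U f g hf hg hfg z₀ ρ hρ hQU γ hγ M hMt hM => ?_⟩
  set Q := Qstar z₀ ρ with hQ
  have hQm : MeasurableSet Q := (isOpen_Qstar z₀ ρ).measurableSet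
  set F := Q.indicator f with hF
  have hFm : Measurable F := hf.indicator hQm
  have hFi : LocallyIntegrable F :=
    ((integrableOn_Qstar hf hMt hM).integrable_indicator hQm).locallyIntegrable
  have hFM : ∀ᵐ t : ℝ, ∫⁻ x : E3, ‖F (x, t)‖ₑ ^ 2 ≤ M := by
    filter_upwards [(ae_restrict_iff' measurableSet_Ioo).mp hM] with t ht
    by_cases hI : t ∈ Istar z₀.2 ρ
    · refine le_trans (le_of_eq ?_) (ht hI)
      rw [← lintegral_indicator (show MeasurableSet (ball3 z₀.1 ρ) from measurableSet_ball)]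
      refine lintegral_congr fun x => ?_
      by_cases hx : x ∈ ball3 z₀.1 ρ
      · rw [indicator_of_mem hx, hF, indicator_of_mem (show (x, t) ∈ Q from ⟨hx, hI⟩)]
      · rw [indicator_of_notMem hx, hF, indicator_of_notMem (fun h : (x, t) ∈ Q => hx h.1)]
        simp
    · have : ∀ x : E3, F (x, t) = 0 := fun x => indicator_of_notMem (fun h => hI h.2) _
      simp [this]
  set r : ℕ → ℝ := fun n => ρ - ρ / (n + 2) with hr
  have hr1 : ∀ n, r n < ρ := fun n => by
    have : 0 < ρ / ((n : ℝ) + 2) := by positivity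
    simp only [hr]
    linarith
  have hr2 : ∀ n, ρ / 2 ≤ r n := fun n => by
    have : ρ / ((n : ℝ) + 2) ≤ ρ / 2 := by
      gcongr
      linarith [(Nat.cast_nonneg n : (0 : ℝ) ≤ n)]
    simp only [hr]
    linarith
  have hr0 : ∀ n, 0 < r n := fun n => (half_pos hρ).trans_le (hr2 n)
  have hrt : Tendsto r atTop (nhds ρ) := by
    have h := (tendsto_const_div_atTop_nhds_zero_nat ρ).comp (tendsto_add_atTop_nat 2)
    have := h.const_sub ρ
    rw [sub_zero] at this
    refine this.congr fun n => ?_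
    simp [hr]
  choose ε hε0 hεn hεQ using fun n : ℕ =>
    exists_closedBall_subset_Qstar z₀ (hr0 n).le (hr1 n) (Nat.one_div_pos_of_nat (α := ℝ) (n := n))
  set φ : ℕ → ContDiffBump (0 : SpT) := fun n =>
    ⟨ε n / 2, ε n, half_pos (hε0 n), half_lt_self (hε0 n)⟩ with hφ
  set Fn : ℕ → SpT → ℝ := fun n =>
    F ⋆[ContinuousLinearMap.mul ℝ ℝ, volume] (φ n).normed volume with hFn
  have hFns : ∀ n, ContDiff ℝ 1 (Fn n) := fun n =>
    (φ n).hasCompactSupport_normed.contDiff_convolution_right _ hFi (φ n).contDiff_normed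
  set N := ∫⁻ z in Q, ∑ j, ‖g j z‖ₑ ^ 2 with hN
  have hNn : ∀ n, ∫⁻ z in Qstar z₀ (r n), ∑ j, ‖sderiv j (Fn n) z‖ₑ ^ 2 ≤ N := by
    intro n
    calc ∫⁻ z in Qstar z₀ (r n), ∑ j, ‖sderiv j (Fn n) z‖ₑ ^ 2
        = ∫⁻ z in Qstar z₀ (r n), ∑ j, ‖(Q.indicator (g j)
            ⋆[ContinuousLinearMap.mul ℝ ℝ, volume] (φ n).normed volume) z‖ₑ ^ 2 := by
          refine setLIntegral_congr_fun (isOpen_Qstar _ _).measurableSet fun z hz => ?_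
          refine Finset.sum_congr rfl fun j _ => ?_
          rw [sderiv_convolution_eq (φ n) hQU hfg hFi (hεQ n z hz) j]
      _ ≤ ∫⁻ z, ∑ j, ‖(Q.indicator (g j)
            ⋆[ContinuousLinearMap.mul ℝ ℝ, volume] (φ n).normed volume) z‖ₑ ^ 2 :=
          setLIntegral_le_lintegral _ _
      _ ≤ ∑ j, ∫⁻ z, ‖Q.indicator (g j) z‖ₑ ^ 2 := by
          rw [lintegral_finsetSum _ fun j _ =>
            (measurable_convolution (φ n) ((hg j).indicator hQm)).enorm.pow_const 2]
          exact Finset.sum_le_sum fun j _ =>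
            lintegral_sq_convolution_le (φ n) ((hg j).indicator hQm)
      _ = N := by
          rw [hN, lintegral_finsetSum _ fun j _ => by have := hg j; fun_prop]
          refine Finset.sum_congr rfl fun j _ => ?_
          rw [← lintegral_indicator hQm]
          refine lintegral_congr fun z => ?_
          by_cases hz : z ∈ Q <;> simp [hz]
  set R := 4 * C * (ENNReal.ofReal (γ ^ 3) * ENNReal.ofReal ρ ^ (-(3 : ℝ) / 2) *
      M ^ ((3 : ℝ) / 2) * ENNReal.ofReal ((γ * ρ) ^ 2) +
    M ^ ((3 : ℝ) / 4) * (ENNReal.ofReal ((γ * ρ) ^ 2) ^ ((1 : ℝ) / 4) * N ^ ((3 : ℝ) / 4))) with hR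
  have hbound : ∀ n, ∫⁻ z, (Qstar z₀ (γ * r n)).indicator (fun z => ‖Fn n z‖ₑ ^ 3) z ≤ R := by
    intro n
    rw [lintegral_indicator (isOpen_Qstar _ _).measurableSet]
    refine (hC (Fn n) (hFns n) z₀ (r n) (hr0 n) γ hγ M fun t _ =>
      (setLIntegral_le_lintegral _ _).trans
        (lintegral_sq_convolution_slice_le (φ n) hFm hFM t)).trans ?_
    have e1 : ENNReal.ofReal (r n) ^ (-(3 : ℝ) / 2) ≤
        4 * ENNReal.ofReal ρ ^ (-(3 : ℝ) / 2) := by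
      rw [ENNReal.ofReal_rpow_of_pos (hr0 n), ENNReal.ofReal_rpow_of_pos hρ,
        show (4 : ℝ≥0∞) = ENNReal.ofReal 4 by simp, ← ENNReal.ofReal_mul (by norm_num)]
      refine ENNReal.ofReal_le_ofReal ?_
      calc r n ^ (-(3 : ℝ) / 2) ≤ (2⁻¹ * ρ) ^ (-(3 : ℝ) / 2) :=
            Real.rpow_le_rpow_of_nonpos (by positivity) (by linarith [hr2 n]) (by norm_num)
        _ = 2 ^ ((3 : ℝ) / 2) * ρ ^ (-(3 : ℝ) / 2) := by
            rw [Real.mul_rpow (by norm_num) hρ.le, Real.inv_rpow (by norm_num),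
              ← Real.rpow_neg (by norm_num)]
            norm_num
        _ ≤ 2 ^ (2 : ℝ) * ρ ^ (-(3 : ℝ) / 2) := by
            gcongr <;> norm_num
        _ = 4 * ρ ^ (-(3 : ℝ) / 2) := by norm_num
    have e2 : (γ * r n) ^ 2 ≤ (γ * ρ) ^ 2 := by
      have := hγ.1
      have := hr0 n
      have := (hr1 n).le
      gcongr
    calc _ ≤ C * (ENNReal.ofReal (γ ^ 3) * (4 * ENNReal.ofReal ρ ^ (-(3 : ℝ) / 2)) *
            M ^ ((3 : ℝ) / 2) * ENNReal.ofReal ((γ * ρ) ^ 2) +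
          4 * (M ^ ((3 : ℝ) / 4) * (ENNReal.ofReal ((γ * ρ) ^ 2) ^ ((1 : ℝ) / 4) *
            N ^ ((3 : ℝ) / 4)))) := by
          refine mul_le_mul_right (add_le_add (by gcongr) ?_) _
          refine le_trans ?_ (le_mul_of_one_le_left zero_le (by norm_num))
          gcongr
          exact hNn n
      _ = R := by rw [hR]; ring
  have hconv : ∀ᵐ z : SpT, Tendsto (fun n => Fn n z) atTop (nhds (F z)) := by
    have hε : Tendsto ε atTop (nhds 0) :=
      squeeze_zero (fun n => (hε0 n).le) hεn tendsto_one_div_add_atTop_nhds_zero_nat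
    filter_upwards [ContDiffBump.ae_convolution_tendsto_right_of_locallyIntegrable
      (φ := φ) (l := atTop) (K := 2) hε (Eventually.of_forall fun n => by
        simp only [hφ]; linarith) hFi] with z hz
    refine hz.congr fun n => ?_
    simp only [hFn]
    rw [convolution_mul_swap, convolution_def]
    exact integral_congr_ae (Eventually.of_forall fun w => by simp [mul_comm])
  have hle : ∀ᵐ z : SpT, (Qstar z₀ (γ * ρ)).indicator (fun z => ‖f z‖ₑ ^ 3) z ≤
      liminf (fun n => (Qstar z₀ (γ * r n)).indicator (fun z => ‖Fn n z‖ₑ ^ 3) z) atTop := by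
    filter_upwards [hconv] with z hz
    by_cases hzQ : z ∈ Qstar z₀ (γ * ρ)
    · have hev : ∀ᶠ n in atTop, z ∈ Qstar z₀ (γ * r n) := by
        have h1 := hrt.const_mul γ
        filter_upwards [h1.eventually_const_lt hzQ.1,
          (((h1.pow 2).const_mul (7 / 8)).const_sub z₀.2).eventually_lt_const hzQ.2.1,
          (((h1.pow 2).const_mul (1 / 8)).const_add z₀.2).eventually_const_lt hzQ.2.2]
          with n h1 h2 h3
        exact ⟨h1, h2, h3⟩
      have hzF : F z = f z := indicator_of_mem
        (Qstar_subset_Qstar z₀ (mul_nonneg hγ.1.le hρ.le) (mul_le_of_le_one_left hρ.le hγ.2) hzQ) _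
      have hlim : Tendsto (fun n => (Qstar z₀ (γ * r n)).indicator (fun z => ‖Fn n z‖ₑ ^ 3) z)
          atTop (nhds (‖f z‖ₑ ^ 3)) := by
        rw [← hzF]
        refine ((ENNReal.continuous_pow 3).tendsto _ |>.comp hz.enorm).congr' ?_
        filter_upwards [hev] with n hn
        rw [indicator_of_mem hn, Function.comp_apply]
      rw [indicator_of_mem hzQ, hlim.liminf_eq]
    · rw [indicator_of_notMem hzQ]
      exact zero_le
  calc ∫⁻ z in Qstar z₀ (γ * ρ), ‖f z‖ₑ ^ 3
      = ∫⁻ z, (Qstar z₀ (γ * ρ)).indicator (fun z => ‖f z‖ₑ ^ 3) z :=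
        (lintegral_indicator (isOpen_Qstar _ _).measurableSet _).symm
    _ ≤ ∫⁻ z, liminf (fun n =>
          (Qstar z₀ (γ * r n)).indicator (fun z => ‖Fn n z‖ₑ ^ 3) z) atTop :=
        lintegral_mono_ae hle
    _ ≤ liminf (fun n =>
          ∫⁻ z, (Qstar z₀ (γ * r n)).indicator (fun z => ‖Fn n z‖ₑ ^ 3) z) atTop :=
        lintegral_liminf_le fun n =>
          ((hFns n).continuous.measurable.enorm.pow_const 3).indicator
            (isOpen_Qstar _ _).measurableSet
    _ ≤ R := liminf_le_of_frequently_le' (Frequently.of_forall hbound)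
    _ = _ := by rw [hR, mul_comm 4 C]

theorem sum_enorm_sq_eq {ι : Type*} (s : Finset ι) (a : ι → ℝ) :
    ∑ i ∈ s, ‖a i‖ₑ ^ 2 = ENNReal.ofReal (∑ i ∈ s, a i ^ 2) := by
  rw [ENNReal.ofReal_sum_of_nonneg fun i _ => sq_nonneg (a i)]
  refine Finset.sum_congr rfl fun i _ => ?_
  rw [← ofReal_norm, ← ENNReal.ofReal_pow (norm_nonneg _), Real.norm_eq_abs, sq_abs]

theorem ofReal_sqrt_cube_le {ι : Type*} [Fintype ι] (a : ι → ℝ) :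
    ENNReal.ofReal (√(∑ i, a i ^ 2) ^ 3) ≤ (Fintype.card ι : ℝ≥0∞) ^ 2 * ∑ i, ‖a i‖ₑ ^ 3 := by
  have h1 : √(∑ i, a i ^ 2) ≤ ∑ i, |a i| := by
    refine Real.sqrt_le_iff.mpr ⟨Finset.sum_nonneg fun _ _ => abs_nonneg _, ?_⟩
    simpa using Finset.sum_sq_le_sq_sum_of_nonneg (s := Finset.univ) (f := fun i => |a i|)
      fun _ _ => abs_nonneg _
  have h2 : (∑ i, |a i|) ^ 3 ≤ (Fintype.card ι : ℝ) ^ 2 * ∑ i, |a i| ^ 3 :=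
    pow_sum_le_card_mul_sum_pow (fun _ _ => abs_nonneg _) 2
  have h3 : ∑ i, ‖a i‖ₑ ^ 3 = ENNReal.ofReal (∑ i, |a i| ^ 3) := by
    rw [ENNReal.ofReal_sum_of_nonneg fun i _ => by positivity]
    refine Finset.sum_congr rfl fun i _ => ?_
    rw [← ofReal_norm, ← ENNReal.ofReal_pow (norm_nonneg _), Real.norm_eq_abs]
  rw [h3, ← ENNReal.ofReal_natCast, ← ENNReal.ofReal_pow (by positivity),
    ← ENNReal.ofReal_mul (by positivity)]
  refine ENNReal.ofReal_le_ofReal (le_trans ?_ h2)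
  gcongr

theorem nsq2_nonneg (M : Fin 3 → Fin 3 → ℝ) : 0 ≤ nsq2 M := by
  unfold nsq2
  positivity

theorem nsq3_nonneg (M : Fin 3 → Fin 3 → Fin 3 → ℝ) : 0 ≤ nsq3 M := by
  unfold nsq3
  positivity

/-- `(γρ)^{-2}` times the scale-explicit bound is controlled by the scale-invariant bound. -/
theorem inv_mul_scaled_bound_le {ρ γ : ℝ} (hρ : 0 < ρ) (hγ : γ ∈ Ioc (0 : ℝ) 1) (M N : ℝ≥0∞) :
    (ENNReal.ofReal ((γ * ρ) ^ 2))⁻¹ *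
        (ENNReal.ofReal (γ ^ 3) * ENNReal.ofReal ρ ^ (-(3 : ℝ) / 2) * M ^ ((3 : ℝ) / 2) *
            ENNReal.ofReal ((γ * ρ) ^ 2) +
          M ^ ((3 : ℝ) / 4) * (ENNReal.ofReal ((γ * ρ) ^ 2) ^ ((1 : ℝ) / 4) *
            N ^ ((3 : ℝ) / 4))) ≤
      ENNReal.ofReal (γ ^ 3) * ((ENNReal.ofReal ρ)⁻¹ * M) ^ ((3 : ℝ) / 2) +
        ENNReal.ofReal (γ ^ (-3 : ℝ)) * ((ENNReal.ofReal ρ)⁻¹ * M) ^ ((3 : ℝ) / 4) *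
          ((ENNReal.ofReal ρ)⁻¹ * N) ^ ((3 : ℝ) / 4) := by
  have hγ0 := hγ.1
  set R := ENNReal.ofReal ρ with hR
  have hR0 : R ≠ 0 := by simpa [R] using hρ
  have hRt : R ≠ ∞ := ENNReal.ofReal_ne_top
  set S := ENNReal.ofReal ((γ * ρ) ^ 2) with hS
  have hS0 : S ≠ 0 := by
    have : 0 < (γ * ρ) ^ 2 := by positivity
    simpa [S, -ENNReal.ofReal_eq_zero] using (ENNReal.ofReal_pos.mpr this).ne'
  have hSt : S ≠ ∞ := ENNReal.ofReal_ne_top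
  have hRi : ∀ a : ℝ, R⁻¹ ^ a = R ^ (-a) := fun a => by rw [ENNReal.inv_rpow, ENNReal.rpow_neg]
  have e1 : S⁻¹ * S ^ ((1 : ℝ) / 4) ≤ ENNReal.ofReal (γ ^ (-3 : ℝ)) * R ^ (-(3 : ℝ) / 2) := by
    rw [← ENNReal.rpow_neg_one, ← ENNReal.rpow_add _ _ hS0 hSt, hS,
      ENNReal.ofReal_rpow_of_pos (by positivity), hR, ENNReal.ofReal_rpow_of_pos hρ,
      ← ENNReal.ofReal_mul (by positivity)]
    refine ENNReal.ofReal_le_ofReal ?_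
    rw [← Real.rpow_natCast, ← Real.rpow_mul (by positivity), Real.mul_rpow hγ0.le hρ.le]
    norm_num
    gcongr
    have := Real.rpow_le_rpow_of_exponent_ge hγ0 hγ.2 (show (-3 : ℝ) ≤ -(3 / 2) by norm_num)
    simpa [Real.rpow_neg hγ0.le] using this
  calc _ = (S⁻¹ * S) * (ENNReal.ofReal (γ ^ 3) * (R ^ (-(3 : ℝ) / 2) * M ^ ((3 : ℝ) / 2))) +
        (S⁻¹ * S ^ ((1 : ℝ) / 4)) * (M ^ ((3 : ℝ) / 4) * N ^ ((3 : ℝ) / 4)) := by ring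
    _ ≤ 1 * (ENNReal.ofReal (γ ^ 3) * (R ^ (-(3 : ℝ) / 2) * M ^ ((3 : ℝ) / 2))) +
        ENNReal.ofReal (γ ^ (-3 : ℝ)) * R ^ (-(3 : ℝ) / 2) *
          (M ^ ((3 : ℝ) / 4) * N ^ ((3 : ℝ) / 4)) := by
        rw [ENNReal.inv_mul_cancel hS0 hSt]
        gcongr
    _ = _ := by
        have e2 : R ^ (-(3 : ℝ) / 2) = R ^ (-((3 : ℝ) / 4)) * R ^ (-((3 : ℝ) / 4)) := by
          rw [← ENNReal.rpow_add _ _ hR0 hRt]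
          norm_num
        simp_rw [ENNReal.mul_rpow_of_nonneg _ _ (show (0 : ℝ) ≤ 3 / 2 by norm_num),
          ENNReal.mul_rpow_of_nonneg _ _ (show (0 : ℝ) ≤ 3 / 4 by norm_num), hRi]
        rw [one_mul, ← neg_div]
        nth_rewrite 2 [e2]
        ring

/-- There is a universal constant `c₁ > 0` such that
`C(γρ) ≤ c₁ (γ³ A(ρ)^{3/2} + γ^{-3} A(ρ)^{3/4} B(ρ)^{3/4})`. -/
theorem stmt11 :
    ∃ c₁ : ℝ, 0 < c₁ ∧
      ∀ (Ω : Set E3), IsOpen Ω → ∀ T : ℝ, 0 < T →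
      ∀ (u d : SpT → E3) (Du Dd : SpT → Fin 3 → Fin 3 → ℝ)
        (D2d : SpT → Fin 3 → Fin 3 → Fin 3 → ℝ),
      StdRegUD Ω T u d Du Dd D2d →
      ∀ (z₀ : SpT) (ρ : ℝ), 0 < ρ → Qstar z₀ ρ ⊆ Ω ×ˢ Ioo 0 T →
      ∀ γ : ℝ, γ ∈ Ioc (0 : ℝ) 1 →
      CQ u Dd z₀ (γ * ρ) ≤ ENNReal.ofReal c₁ *
        (ENNReal.ofReal (γ ^ 3) * AQ u Dd z₀ ρ ^ ((3 : ℝ) / 2) +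
         ENNReal.ofReal (γ ^ (-3 : ℝ)) * AQ u Dd z₀ ρ ^ ((3 : ℝ) / 4) *
           BQ Du D2d z₀ ρ ^ ((3 : ℝ) / 4)) := by
  obtain ⟨C, hCt, hC⟩ := exists_lintegral_cube_le_of_weakSGrad
  refine ⟨(81 * 12 * C).toReal + 1, by positivity,
    fun Ω _ T _ u d Du Dd D2d h z₀ ρ hρ hQ γ hγ => ?_⟩
  have hc : 81 * 12 * C ≤ ENNReal.ofReal ((81 * 12 * C).toReal + 1) := by
    rw [← ENNReal.ofReal_toReal (a := 81 * 12 * C) (by finiteness),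
      ENNReal.toReal_ofReal ENNReal.toReal_nonneg]
    exact ENNReal.ofReal_le_ofReal (by linarith)
  have hu := h.meas_u
  have hDd := h.meas_Dd
  have hui : ∀ i, Measurable fun z => u z i := fun i => by fun_prop
  have hDdi : ∀ i k, Measurable fun z => Dd z i k := fun i k => by fun_prop
  set M := essSup (fun t => ∫⁻ x in ball3 z₀.1 ρ,
    ENNReal.ofReal (‖u (x, t)‖ ^ 2 + nsq2 (Dd (x, t)))) (volume.restrict (Istar z₀.2 ρ)) with hM
  set N := ∫⁻ z in Qstar z₀ ρ, ENNReal.ofReal (nsq2 (Du z) + nsq3 (D2d z)) with hN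
  have hA : AQ u Dd z₀ ρ = (ENNReal.ofReal ρ)⁻¹ * M := rfl
  have hB : BQ Du D2d z₀ ρ = (ENNReal.ofReal ρ)⁻¹ * N := rfl
  rw [hA, hB]
  by_cases hMt : M = ∞
  · have h1 : (ENNReal.ofReal ρ)⁻¹ * M = ∞ := by
      rw [hMt, ENNReal.mul_top (by simp)]
    have h2 : ENNReal.ofReal (γ ^ 3) ≠ 0 := (ENNReal.ofReal_pos.mpr (pow_pos hγ.1 3)).ne'
    have h3 : ENNReal.ofReal ((81 * 12 * C).toReal + 1) ≠ 0 :=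
      (ENNReal.ofReal_pos.mpr (by positivity)).ne'
    rw [h1, ENNReal.top_rpow_of_pos (by norm_num), ENNReal.mul_top h2, top_add, ENNReal.mul_top h3]
    exact le_top
  have hMae : ∀ᵐ t ∂(volume.restrict (Istar z₀.2 ρ)), ∫⁻ x in ball3 z₀.1 ρ,
      ENNReal.ofReal (‖u (x, t)‖ ^ 2 + nsq2 (Dd (x, t))) ≤ M := ENNReal.ae_le_essSup _
  set Z := ENNReal.ofReal (γ ^ 3) * ENNReal.ofReal ρ ^ (-(3 : ℝ) / 2) * M ^ ((3 : ℝ) / 2) *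
      ENNReal.ofReal ((γ * ρ) ^ 2) +
    M ^ ((3 : ℝ) / 4) * (ENNReal.ofReal ((γ * ρ) ^ 2) ^ ((1 : ℝ) / 4) * N ^ ((3 : ℝ) / 4)) with hZ
  have key : ∀ (f : SpT → ℝ) (g : Fin 3 → SpT → ℝ), Measurable f → (∀ j, Measurable (g j)) →
      WeakSGrad (Ω ×ˢ Ioo 0 T) f g → (∀ z, f z ^ 2 ≤ ‖u z‖ ^ 2 + nsq2 (Dd z)) →
      (∀ z, ∑ j, g j z ^ 2 ≤ nsq2 (Du z) + nsq3 (D2d z)) →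
      ∫⁻ z in Qstar z₀ (γ * ρ), ‖f z‖ₑ ^ 3 ≤ C * Z := by
    intro f g hf hg hfg hfu hgD
    have hfM : ∀ᵐ t ∂(volume.restrict (Istar z₀.2 ρ)),
        ∫⁻ x in ball3 z₀.1 ρ, ‖f (x, t)‖ₑ ^ 2 ≤ M := by
      filter_upwards [hMae] with t ht
      refine (lintegral_mono fun x => ?_).trans ht
      simpa using (sum_enorm_sq_eq {()} fun _ => f (x, t)).trans_le
        (ENNReal.ofReal_le_ofReal (by simpa using hfu (x, t)))
    refine (hC _ f g hf hg hfg z₀ ρ hρ hQ γ hγ M hMt hfM).trans ?_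
    rw [hZ, hN]
    gcongr with z
    rw [sum_enorm_sq_eq]
    exact ENNReal.ofReal_le_ofReal (hgD z)
  have hukey : ∀ i, ∫⁻ z in Qstar z₀ (γ * ρ), ‖u z i‖ₑ ^ 3 ≤ C * Z := fun i => by
    refine key _ _ (hui i) (fun j => by have := h.meas_Du; fun_prop) (h.grad_u i) (fun z => ?_)
      fun z => ?_
    · have h1 : u z i ^ 2 ≤ ‖u z‖ ^ 2 := by
        rw [EuclideanSpace.real_norm_sq_eq]
        exact Finset.single_le_sum (f := fun i => u z i ^ 2) (fun _ _ => sq_nonneg _)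
          (Finset.mem_univ i)
      linarith [nsq2_nonneg (Dd z)]
    · have h1 : ∑ j, Du z i j ^ 2 ≤ nsq2 (Du z) :=
        Finset.single_le_sum (f := fun i => ∑ j, Du z i j ^ 2) (fun _ _ => by positivity)
          (Finset.mem_univ i)
      linarith [nsq3_nonneg (D2d z)]
  have hDkey : ∀ p : Fin 3 × Fin 3,
      ∫⁻ z in Qstar z₀ (γ * ρ), ‖Dd z p.1 p.2‖ₑ ^ 3 ≤ C * Z := fun ⟨i, k⟩ => by
    refine key _ _ (hDdi i k) (fun j => by have := h.meas_D2d; fun_prop) (h.grad_Dd i k)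
      (fun z => ?_) fun z => ?_
    · have h1 : Dd z i k ^ 2 ≤ ∑ k, Dd z i k ^ 2 :=
        Finset.single_le_sum (f := fun k => Dd z i k ^ 2) (fun _ _ => sq_nonneg _)
          (Finset.mem_univ k)
      have h2 : ∑ k, Dd z i k ^ 2 ≤ nsq2 (Dd z) :=
        Finset.single_le_sum (f := fun i => ∑ k, Dd z i k ^ 2) (fun _ _ => by positivity)
          (Finset.mem_univ i)
      linarith [sq_nonneg ‖u z‖]
    · have h1 : ∑ j, D2d z i j k ^ 2 ≤ ∑ j, ∑ k, D2d z i j k ^ 2 :=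
        Finset.sum_le_sum fun j _ => Finset.single_le_sum (f := fun k => D2d z i j k ^ 2)
          (fun _ _ => sq_nonneg _) (Finset.mem_univ k)
      have h2 : ∑ j, ∑ k, D2d z i j k ^ 2 ≤ nsq3 (D2d z) :=
        Finset.single_le_sum (f := fun i => ∑ j, ∑ k, D2d z i j k ^ 2)
          (fun _ _ => by positivity) (Finset.mem_univ i)
      linarith [nsq2_nonneg (Du z)]
  have hpt : ∀ z, ENNReal.ofReal (‖u z‖ ^ 3 + √(nsq2 (Dd z)) ^ 3) ≤
      81 * ((∑ i, ‖u z i‖ₑ ^ 3) + ∑ p : Fin 3 × Fin 3, ‖Dd z p.1 p.2‖ₑ ^ 3) := by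
    intro z
    rw [ENNReal.ofReal_add (by positivity) (by positivity), mul_add]
    refine add_le_add ?_ ?_
    · have h1 := ofReal_sqrt_cube_le fun i => u z i
      rw [← EuclideanSpace.real_norm_sq_eq, Real.sqrt_sq (norm_nonneg _)] at h1
      refine h1.trans ?_
      gcongr
      norm_num
    · have h1 := ofReal_sqrt_cube_le fun p : Fin 3 × Fin 3 => Dd z p.1 p.2
      rw [Fintype.sum_prod_type (f := fun p : Fin 3 × Fin 3 => Dd z p.1 p.2 ^ 2)] at h1
      refine h1.trans ?_
      gcongr
      norm_num
  have hsum : ∫⁻ z in Qstar z₀ (γ * ρ), ENNReal.ofReal (‖u z‖ ^ 3 + √(nsq2 (Dd z)) ^ 3) ≤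
      81 * 12 * C * Z := by
    refine (lintegral_mono hpt).trans ?_
    rw [lintegral_const_mul _ (by fun_prop), lintegral_add_left (by fun_prop),
      lintegral_finsetSum _ fun i _ => by fun_prop,
      lintegral_finsetSum _ fun p _ => by fun_prop]
    calc _ ≤ 81 * ((∑ _i : Fin 3, C * Z) + ∑ _p : Fin 3 × Fin 3, C * Z) := by
          gcongr with i _ p _
          · exact hukey i
          · exact hDkey p
      _ = _ := by
          simp only [Finset.sum_const, Finset.card_univ, Fintype.card_prod, Fintype.card_fin,
            nsmul_eq_mul]
          push_cast
          ring
  calc CQ u Dd z₀ (γ * ρ) ≤ (ENNReal.ofReal ((γ * ρ) ^ 2))⁻¹ * (81 * 12 * C * Z) :=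
        mul_le_mul_right hsum _
    _ = 81 * 12 * C * ((ENNReal.ofReal ((γ * ρ) ^ 2))⁻¹ * Z) := by ring
    _ ≤ _ := mul_le_mul' hc (inv_mul_scaled_bound_le hρ hγ M N)
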